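/- (Selberg) For every ε with 0 < ε < 2/3 and every A > 0 there exists a constant C = C(ε,A) such that for every real X ≥ 2, every prime q with q ≤ X^{2/3−ε}, and every integer a coprime to q, one has |E_X(d; q, a)| ≤ C (X/q) (log X)^{−A}. -/

import Mathlib

section Stepanov

open Polynomial

variable {F : Type*} [Field F]

theorem eq_zero_of_eval_X_pow_eq_zero {P : ℕ} (Q : F[X][X])
    (hQ : ∀ j, (Q.coeff j).natDegree < P) (h : Q.eval (X ^ P) = 0) : Q = 0 := by
  ext j i
  by_cases hi : P ≤ i
  · simp [coeff_eq_zero_of_natDegree_lt ((hQ j).trans_le hi)]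
  push Not at hi
  by_cases hj : Q.natDegree < j
  · simp [coeff_eq_zero_of_natDegree_lt hj]
  push Not at hj
  have h1 := congrArg (fun f => coeff f (j * P + i)) h
  simp only [eval_eq_sum_range, finsetSum_coeff, ← pow_mul, coeff_mul_X_pow', coeff_zero] at h1
  rw [Finset.sum_eq_single j] at h1
  · rw [mul_comm P j, if_pos (Nat.le_add_right _ _), Nat.add_sub_cancel_left] at h1
    simpa using h1
  · intro k _ hk
    split_ifs with hle
    · apply coeff_eq_zero_of_natDegree_lt
      have hkj : k < j := by
        rcases lt_or_gt_of_ne hk with h' | h'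
        · exact h'
        · exfalso
          have : P * (j + 1) ≤ P * k := Nat.mul_le_mul_left _ h'
          nlinarith
      have : P * (k + 1) ≤ P * j := Nat.mul_le_mul_left _ hkj
      have := hQ k
      apply this.trans_le
      apply Nat.le_sub_of_add_le
      nlinarith
    · rfl
  · intro h'
    exact absurd (Finset.mem_range.2 (Nat.lt_succ_of_le hj)) h'

theorem natDegree_coeff_mul_le {A B : F[X][X]} {a b : ℕ} (hA : ∀ j, (A.coeff j).natDegree ≤ a)
    (hB : ∀ j, (B.coeff j).natDegree ≤ b) (j : ℕ) : ((A * B).coeff j).natDegree ≤ a + b := by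
  rw [coeff_mul]
  exact natDegree_sum_le_of_forall_le _ _ fun x _ =>
    natDegree_mul_le.trans (add_le_add (hA _) (hB _))

theorem eq_zero_of_sq_eq_squarefree_mul_sq {f r s : F[X]} (hf : Squarefree f)
    (hf0 : 0 < f.natDegree) {c : F} (hc : c ≠ 0) (h : r ^ 2 = C c * f * s ^ 2) : s = 0 := by
  by_contra hs
  obtain ⟨u, rfl⟩ : s ∣ r := (IsIntegrallyClosed.pow_dvd_pow_iff two_ne_zero).1 ⟨C c * f, by rw [h, mul_comm]⟩
  have hu : u * u = C c * f := by
    apply mul_left_cancel₀ (pow_ne_zero 2 hs)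
    linear_combination h
  have hu2 : u * u ∣ f :=
    (IsUnit.dvd_mul_left (isUnit_C.2 (isUnit_iff_ne_zero.2 hc))).1 (Dvd.intro_left 1 (by rw [one_mul, hu]))
  have h3 := hf u hu2
  have h4 : natDegree (u * u) = 0 := natDegree_eq_zero_of_isUnit (h3.mul h3)
  rw [hu, natDegree_C_mul hc] at h4
  omega

theorem eq_zero_of_eval_add_pow_mul_eval_eq_zero (p : ℕ) [ExpChar F p] {k h g : ℕ}
    (hP : p ^ k = 2 * h + 1) {f : F[X]} (hf : Squarefree f) (hfd : f.natDegree = 2 * g)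
    (hg : 0 < g) (hgh : g ≤ h) {r s : F[X][X]} (hr : ∀ j, (r.coeff j).natDegree ≤ h)
    (hs : ∀ j, (s.coeff j).natDegree ≤ h - g)
    (h0 : r.eval (X ^ (p ^ k)) + f ^ (h + 1) * s.eval (X ^ (p ^ k)) = 0) : r = 0 ∧ s = 0 := by
  set φ : F[X] := f.map (iterateFrobenius F p k) with hφ
  have hφe : (φ.map C).eval (X ^ (p ^ k)) = f ^ p ^ k := by
    rw [← map_iterateFrobenius_expand p f k, eval_map, ← comp, ← expand_eq_comp_X_pow, hφ,
      map_expand]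
  have hf0 : f ≠ 0 := hf.ne_zero
  have hφ0 : φ ≠ 0 := by rwa [hφ, Ne, Polynomial.map_eq_zero]
  have key : r ^ 2 - C f * φ.map C * s ^ 2 = 0 := by
    apply eq_zero_of_eval_X_pow_eq_zero (P := p ^ k)
    · intro j
      rw [coeff_sub]
      apply Nat.lt_of_le_of_lt (m := 2 * h) _ (by omega)
      apply (natDegree_sub_le _ _).trans
      apply max_le
      · rw [pow_two, two_mul]
        exact natDegree_coeff_mul_le hr hr j
      · have h1 : ∀ j, ((s ^ 2).coeff j).natDegree ≤ (h - g) + (h - g) := fun j => by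
          rw [pow_two]
          exact natDegree_coeff_mul_le hs hs j
        have h2 : ∀ j, ((C f * φ.map C).coeff j).natDegree ≤ 2 * g := fun j => by
          rw [coeff_C_mul, coeff_map]
          exact natDegree_mul_le.trans (by rw [natDegree_C, hfd, add_zero])
        exact (natDegree_coeff_mul_le h2 h1 j).trans (by omega)
    · simp only [eval_sub, eval_pow, eval_mul, eval_C, hφe]
      have : r.eval (X ^ (p ^ k)) = - (f ^ (h + 1) * s.eval (X ^ (p ^ k))) :=
        eq_neg_of_add_eq_zero_left h0
      rw [this, hP]
      ring
  have hlc := congrArg leadingCoeff (sub_eq_zero.1 key)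
  rw [leadingCoeff_pow, leadingCoeff_mul, leadingCoeff_mul, leadingCoeff_pow, leadingCoeff_C,
    leadingCoeff_map_of_injective (C_injective), mul_comm f] at hlc
  have hs0 : s = 0 := leadingCoeff_eq_zero.1
    (eq_zero_of_sq_eq_squarefree_mul_sq hf (by omega) (leadingCoeff_ne_zero.2 hφ0) hlc)
  refine ⟨?_, hs0⟩
  rw [hs0] at key
  simpa using key

/-- A bivariate polynomial with prescribed coefficients in a box. -/
noncomputable def boxPolynomial {m n : ℕ} (c : Fin m × Fin n → F) : F[X][X] :=
  ∑ x, monomial (x.1 : ℕ) (monomial (x.2 : ℕ) (c x))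

theorem coeff_coeff_boxPolynomial {m n : ℕ} (c : Fin m × Fin n → F) (x : Fin m × Fin n) :
    ((boxPolynomial c).coeff x.1).coeff x.2 = c x := by
  rw [boxPolynomial, finsetSum_coeff, finsetSum_coeff, Finset.sum_eq_single x]
  · simp
  · intro y _ hy
    rw [coeff_monomial]
    split_ifs with h1
    · rw [coeff_monomial]
      split_ifs with h2
      · exact absurd (Prod.ext (Fin.ext h1) (Fin.ext h2)) hy
      · rfl
    · simp
  · simp

theorem natDegree_coeff_boxPolynomial_le {m n : ℕ} (c : Fin m × Fin (n + 1) → F) (j : ℕ) :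
    ((boxPolynomial c).coeff j).natDegree ≤ n := by
  rw [boxPolynomial, finsetSum_coeff]
  refine natDegree_sum_le_of_forall_le _ _ fun x _ => ?_
  rw [coeff_monomial]
  split_ifs
  · exact (natDegree_monomial_le _).trans (by omega)
  · simp

theorem eval_boxPolynomial {m n : ℕ} (c : Fin m × Fin n → F) (P : ℕ) :
    (boxPolynomial c).eval (X ^ P) = ∑ x, C (c x) * X ^ ((x.2 : ℕ) + P * x.1) := by
  rw [boxPolynomial, eval_finsetSum]
  refine Finset.sum_congr rfl fun x _ => ?_
  rw [eval_monomial, ← C_mul_X_pow_eq_monomial, ← pow_mul, mul_assoc, pow_add]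

theorem exists_linear_relation {ι : Type*} [Fintype ι] (w : ι → F[X]) {E : ℕ}
    (hw : ∀ i, (w i).natDegree < E) (hE : E < Fintype.card ι) :
    ∃ c : ι → F, ∑ i, C (c i) * w i = 0 ∧ ∃ i, c i ≠ 0 := by
  have hw' : ∀ i, w i ∈ degreeLT F E := fun i =>
    mem_degreeLT.2 (degree_le_natDegree.trans_lt (by exact_mod_cast hw i))
  have hfin : Module.finrank F (degreeLT F E) = E := by
    rw [(degreeLTEquiv F E).finrank_eq]
    simp
  have : Module.Finite F (degreeLT F E) := Module.Finite.equiv (degreeLTEquiv F E).symm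
  have hli : ¬ LinearIndependent F (fun i => (⟨w i, hw' i⟩ : degreeLT F E)) := fun hli => by
    have := hli.fintype_card_le_finrank
    omega
  obtain ⟨c, hc, hi⟩ := Fintype.not_linearIndependent_iff.1 hli
  refine ⟨c, ?_, hi⟩
  have := congrArg (Submodule.subtype _) hc
  simpa [smul_eq_C_mul] using this

/-- **Stepanov's bound** for the number of values at which a squarefree polynomial of even degree
is a square, over a finite field of square order. -/
theorem two_mul_card_isSquare_le [Fintype F] [DecidableEq F] (p : ℕ) [Fact p.Prime] [CharP F p]
    {k h g : ℕ} (hP : p ^ k = 2 * h + 1) (hq : Fintype.card F = (p ^ k) ^ 2) {f : F[X]}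
    (hf : Squarefree f) (hfd : f.natDegree = 2 * g) (hg : 0 < g) (hgP : g ^ 2 + 2 * g < p ^ k)
    (T : Finset F) (hT : ∀ t ∈ T, IsSquare (f.eval t)) :
    2 * T.card ≤ (p ^ k) ^ 2 + 3 * g * p ^ k := by
  set P := p ^ k with hPdef
  have hgh : g ≤ h := by nlinarith
  obtain ⟨J, hJ1, hJ2⟩ : ∃ J, P + g ≤ 2 * J ∧ 2 * J ≤ P + g + 1 := ⟨(P + g + 1) / 2, by omega, by omega⟩
  obtain ⟨b, rfl⟩ : ∃ b, h = g + b := ⟨h - g, by omega⟩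
  set w : (Fin J × Fin (g + b + 1)) ⊕ (Fin J × Fin (b + 1)) → F[X] :=
    Sum.elim (fun x => X ^ (P * x.2 + x.1)) (fun x => f ^ (g + b + 1) * X ^ (P * x.2 + x.1)) with hwdef
  have hwdeg : ∀ i, (w i).natDegree < (g + b) * P + J + g := by
    rintro (⟨j, i⟩ | ⟨j, i⟩)
    · simp only [hwdef, Sum.elim_inl, natDegree_X_pow]
      have := j.2
      have : P * (i : ℕ) ≤ P * (g + b) := Nat.mul_le_mul_left _ (by omega)
      nlinarith
    · simp only [hwdef, Sum.elim_inr]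
      apply natDegree_mul_le.trans_lt
      rw [natDegree_X_pow, natDegree_pow, hfd]
      have := j.2
      have : P * (i : ℕ) ≤ P * b := Nat.mul_le_mul_left _ (by omega)
      nlinarith
  obtain ⟨c, hc, hne⟩ := exists_linear_relation w hwdeg (by
    simp only [Fintype.card_sum, Fintype.card_prod, Fintype.card_fin]
    nlinarith)
  have hfrob : Function.Surjective (fun x : F => x ^ P) := by
    have := (bijective_iterateFrobenius F p k).surjective
    exact fun y => (this y).imp fun x hx => by rw [← hx, iterateFrobenius_def]
  choose ρ hρ using hfrob
  set r := boxPolynomial (fun x : Fin J × Fin (g + b + 1) => ρ (c (Sum.inl x)))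
  set s := boxPolynomial (fun x : Fin J × Fin (b + 1) => ρ (c (Sum.inr x)))
  set κ := r.eval (X ^ P) + f ^ (g + b + 1) * s.eval (X ^ P) with hκ
  have hP0 : P ≠ 0 := by omega
  have hκ0 : κ ≠ 0 := by
    intro h0
    obtain ⟨h1, h2⟩ := eq_zero_of_eval_add_pow_mul_eval_eq_zero p hP hf hfd hg hgh
      (natDegree_coeff_boxPolynomial_le _)
      (fun j => (natDegree_coeff_boxPolynomial_le _ j).trans (by omega)) h0
    obtain ⟨i | i, hi⟩ := hne
    · apply hi
      rw [← hρ (c (Sum.inl i)), ← coeff_coeff_boxPolynomial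
        (fun x : Fin J × Fin (g + b + 1) => ρ (c (Sum.inl x))) i]
      simp [h1, hP0]
    · apply hi
      rw [← hρ (c (Sum.inr i)), ← coeff_coeff_boxPolynomial
        (fun x : Fin J × Fin (b + 1) => ρ (c (Sum.inr x))) i]
      simp [h2, hP0]
  have hκdeg : 2 * κ.natDegree ≤ P ^ 2 + 3 * g * P := by
    have h1 : κ.natDegree ≤ (g + b) + P * (J - 1) + g * P := by
      apply (natDegree_add_le _ _).trans
      apply max_le
      · simp only [r, eval_boxPolynomial]
        refine natDegree_sum_le_of_forall_le _ _ fun x _ => (natDegree_C_mul_X_pow_le _ _).trans ?_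
        have : P * (x.1 : ℕ) ≤ P * (J - 1) := Nat.mul_le_mul_left _ (by omega)
        have := x.2.2
        have := Nat.zero_le (g * P)
        omega
      · apply natDegree_mul_le.trans
        have h2 : (s.eval (X ^ P)).natDegree ≤ b + P * (J - 1) := by
          simp only [s, eval_boxPolynomial]
          refine natDegree_sum_le_of_forall_le _ _ fun x _ => (natDegree_C_mul_X_pow_le _ _).trans ?_
          have : P * (x.1 : ℕ) ≤ P * (J - 1) := Nat.mul_le_mul_left _ (by omega)
          have := x.2.2
          omega
        rw [natDegree_pow, hfd]
        nlinarith
    obtain ⟨J, rfl⟩ : ∃ J', J = J' + 1 := ⟨J - 1, by omega⟩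
    rw [Nat.add_sub_cancel] at h1
    nlinarith
  have hroots : T.card ≤ κ.natDegree := by
    apply card_le_degree_of_subset_roots
    intro t ht
    rw [mem_roots hκ0, IsRoot]
    have ht' : t ∈ T := by simpa using ht
    obtain ⟨u, hu⟩ := hT t ht'
    have hq' : ∀ x : F, (x ^ P) ^ P = x := fun x => by
      rw [← pow_mul, ← pow_two, ← hq, FiniteField.pow_card]
    have hfP : (f.eval t) ^ ((g + b + 1) * P) = (f.eval t) ^ (g + b + 1) := by
      have e1 : (f.eval t) ^ (g + b + 1) = u ^ (P + 1) := by
        rw [hu, ← pow_two, ← pow_mul]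
        congr 1
        omega
      rw [pow_mul, e1, pow_succ, mul_pow, hq', mul_comm]
    have hsum : ∀ {κ : Type} [Fintype κ] (a : κ → F), (∑ i, a i) ^ P = ∑ i, a i ^ P := fun a => by
      have := map_sum (iterateFrobenius F p k) a Finset.univ
      simpa only [iterateFrobenius_def] using this
    have hadd : ∀ a b : F, (a + b) ^ P = a ^ P + b ^ P := fun a b => by
      simpa only [iterateFrobenius_def] using map_add (iterateFrobenius F p k) a b
    have hterm : ∀ (x : F) (i j : ℕ), (x * t ^ (i + P * j)) ^ P = x ^ P * t ^ (P * i + j) := by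
      intro x i j
      rw [mul_pow, pow_add, mul_pow, pow_add, pow_mul t P j, ← pow_mul (t ^ P), mul_comm j P,
        pow_mul (t ^ P), hq', ← pow_mul, mul_comm i P]
    have hz : (κ.eval t) ^ P = 0 := by
      have hc' := congrArg (eval t) hc
      simp only [Fintype.sum_sum_type, hwdef, Sum.elim_inl, Sum.elim_inr, eval_add, eval_finsetSum,
        eval_mul, eval_C, eval_pow, eval_X, eval_zero] at hc'
      simp only [hκ, r, s, eval_boxPolynomial, eval_add, eval_mul, eval_pow, eval_finsetSum, eval_C,
        eval_X, hadd, mul_pow _ (Finset.sum _ _), hsum, hterm, ← pow_mul, hfP]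
      simp only [hρ]
      rw [← hc', Finset.mul_sum]
      congr 1
      refine Finset.sum_congr rfl fun x _ => by ring
    exact eq_zero_of_pow_eq_zero hz
  omega

end Stepanov

section Kloosterman

open Polynomial

variable {F : Type*} [Field F]

theorem natDegree_discriminant (p : ℕ) (hp : 1 < p) (b c : F) :
    ((X ^ p - X + C c : F[X]) ^ 2 - C b).natDegree = 2 * p := by
  have h1 : (X ^ p - X + C c : F[X]).natDegree = p := by
    rw [sub_add, natDegree_sub_eq_left_of_natDegree_lt, natDegree_X_pow]
    rw [natDegree_X_pow, natDegree_sub_C, natDegree_X]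
    exact hp
  rw [natDegree_sub_C, natDegree_pow, h1]

theorem squarefree_discriminant (p : ℕ) [CharP F p] (h2 : (2 : F) ≠ 0) {b : F} (hb : b ≠ 0)
    (c : F) : Squarefree ((X ^ p - X + C c : F[X]) ^ 2 - C b) := by
  apply Separable.squarefree
  set w : F[X] := X ^ p - X + C c with hw
  have hdw : derivative w = -1 := by
    simp [hw, derivative_X_pow]
  have hd : derivative (w ^ 2 - C b) = - (C 2 * w) := by
    simp [pow_two, hdw]
    simp only [map_ofNat]
    ring
  refine ⟨- C b⁻¹, - C (2⁻¹ * b⁻¹) * w, ?_⟩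
  rw [hd]
  have e1 : (C b⁻¹ : F[X]) * C b = 1 := by rw [← C_mul, inv_mul_cancel₀ hb, C_1]
  have e2 : (C 2⁻¹ : F[X]) * C 2 = 1 := by rw [← C_mul, inv_mul_cancel₀ h2, C_1]
  rw [C_mul]
  linear_combination e1 + C b⁻¹ * w ^ 2 * e2

variable [Fintype F] [DecidableEq F]

/-- The Kloosterman sum `∑_{x ≠ 0} Ψ(x + b / x)` over a finite field. -/
noncomputable def kloostermanSum (Ψ : AddChar F ℂ) (b : F) : ℂ :=
  ∑ x ∈ ({0}ᶜ : Finset F), Ψ (x + b / x)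

theorem card_add_div_eq_le (b w : F) :
    (({0}ᶜ : Finset F).filter fun x => x + b / x = w).card ≤ 2 := by
  set Q : F[X] := X ^ 2 - C w * X + C b with hQ
  have hd : Q.natDegree = 2 := by rw [hQ]; compute_degree!
  rw [← hd]
  apply card_le_degree_of_subset_roots
  intro x hx
  have hx' : x ≠ 0 ∧ x + b / x = w := by simpa using hx
  rw [mem_roots (by rintro h; simp [h] at hd), IsRoot, hQ]
  obtain ⟨h0, rfl⟩ := hx'
  simp only [eval_add, eval_sub, eval_pow, eval_X, eval_mul, eval_C]
  field_simp
  ring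

theorem card_add_div_eq_artinSchreier_le (p : ℕ) [Fact p.Prime] [CharP F p] (hp2 : p ≠ 2) {k : ℕ}
    (hq : Fintype.card F = (p ^ k) ^ 2) (hpk : p ^ 2 + 2 * p < p ^ k) {b : F} (hb : b ≠ 0) (c : F) :
    ∑ t : F, (({0}ᶜ : Finset F).filter fun x => x + b / x = t ^ p - t + c).card
      ≤ (p ^ k) ^ 2 + 3 * p * p ^ k := by
  have hp : p.Prime := Fact.out
  have h2 : (2 : F) ≠ 0 := Ring.two_ne_zero (by rwa [ringChar.eq F p])
  have h4 : (4 : F) * b ≠ 0 := mul_ne_zero (by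
    rw [show (4 : F) = 2 * 2 by norm_num]; exact mul_ne_zero h2 h2) hb
  obtain ⟨h, hh⟩ : ∃ h, p ^ k = 2 * h + 1 := (hp.odd_of_ne_two hp2).pow
  classical
  set f : F[X] := (X ^ p - X + C c) ^ 2 - C (4 * b) with hf
  set T := Finset.univ.filter fun t : F => IsSquare (f.eval t)
  have hT := two_mul_card_isSquare_le p hh hq (squarefree_discriminant p h2 h4 c)
    (natDegree_discriminant p hp.one_lt _ c) hp.pos hpk T (fun t ht => (Finset.mem_filter.1 ht).2)
  apply le_trans _ hT
  rw [mul_comm, ← smul_eq_mul, ← Finset.sum_const, Finset.sum_filter]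
  refine Finset.sum_le_sum fun t _ => ?_
  split_ifs with ht
  · exact card_add_div_eq_le _ _
  · rw [Nat.le_zero, Finset.card_eq_zero, Finset.filter_eq_empty_iff]
    intro x hx hxt
    apply ht
    have hx0 : x ≠ 0 := by simpa using hx
    refine ⟨2 * x - (t ^ p - t + c), ?_⟩
    simp only [hf, eval_sub, eval_pow, eval_add, eval_X, eval_C]
    rw [← hxt]
    field_simp
    ring

theorem norm_kloostermanSum_le_of_card_eq (p : ℕ) [Fact p.Prime] [CharP F p] (hp2 : p ≠ 2) {k : ℕ}
    (hq : Fintype.card F = (p ^ k) ^ 2) (hpk : p ^ 2 + 2 * p < p ^ k) {b : F} (hb : b ≠ 0)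
    {Ψ : AddChar F ℂ} (hΨ : Ψ ≠ 1) (hΨp : ∀ t, Ψ (t ^ p) = Ψ t) :
    ‖kloostermanSum Ψ b‖ ≤ 3 * p * p ^ k + 1 := by
  set M : F → ℕ := fun c =>
    ∑ t : F, (({0}ᶜ : Finset F).filter fun x => x + b / x = t ^ p - t + c).card with hM
  set q : ℝ := (Fintype.card F : ℝ) with hqdef
  have hq0 : 0 < q := by rw [hqdef]; exact_mod_cast Fintype.card_pos
  set B : ℝ := q + 3 * p * p ^ k with hB
  have hMB : ∀ c, (M c : ℝ) ≤ B := fun c => by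
    have := card_add_div_eq_artinSchreier_le p hp2 hq hpk hb c
    rw [← hq] at this
    rw [hB, hqdef]
    exact_mod_cast this
  have hcount : ∀ Φ : F → ℂ, ∑ c, Φ c * (M c : ℂ) =
      ∑ x ∈ ({0}ᶜ : Finset F), ∑ t : F, Φ (x + b / x - (t ^ p - t)) := by
    intro Φ
    have h1 : ∀ c, Φ c * (M c : ℂ) = ∑ t : F, ∑ x ∈ ({0}ᶜ : Finset F),
        if c = x + b / x - (t ^ p - t) then Φ c else 0 := by
      intro c
      simp only [hM, Finset.card_filter, Nat.cast_sum, Finset.mul_sum]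
      refine Finset.sum_congr rfl fun t _ => Finset.sum_congr rfl fun x _ => ?_
      by_cases h : x + b / x = t ^ p - t + c
      · rw [if_pos h, if_pos (by rw [h]; ring)]
        simp
      · rw [if_neg h, if_neg (fun h' => h (by rw [h']; ring))]
        simp
    simp only [h1]
    have h2 : ∀ t : F, ∑ c, ∑ x ∈ ({0}ᶜ : Finset F),
        (if c = x + b / x - (t ^ p - t) then Φ c else 0)
        = ∑ x ∈ ({0}ᶜ : Finset F), Φ (x + b / x - (t ^ p - t)) := by
      intro t
      rw [Finset.sum_comm]
      simp
    rw [Finset.sum_comm]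
    simp only [h2]
    rw [Finset.sum_comm]
  have hcard : ((({0}ᶜ : Finset F).card : ℕ) : ℝ) = q - 1 := by
    rw [Finset.card_compl, Finset.card_singleton, Nat.cast_sub Fintype.card_pos]
    simp [hqdef]
  have hsumM : ∑ c, (M c : ℝ) = (q - 1) * q := by
    have h3 := hcount fun _ => 1
    have h4 : ((∑ c, (M c : ℝ) : ℝ) : ℂ) = (((q - 1) * q : ℝ) : ℂ) := by
      rw [← hcard]
      push_cast
      simpa [hqdef] using h3
    exact_mod_cast h4
  have hK : (q : ℂ) * kloostermanSum Ψ b = ∑ c, Ψ c * (M c : ℂ) := by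
    rw [hcount, kloostermanSum, Finset.mul_sum]
    refine Finset.sum_congr rfl fun x _ => ?_
    have : ∀ t : F, Ψ (x + b / x - (t ^ p - t)) = Ψ (x + b / x) := fun t => by
      rw [AddChar.map_sub_eq_div, AddChar.map_sub_eq_div, hΨp, div_self, div_one]
      exact norm_ne_zero_iff.1 (by rw [AddChar.norm_apply]; exact one_ne_zero)
    simp [this, hqdef]
  have hK' : (q : ℂ) * kloostermanSum Ψ b = - ∑ c, Ψ c * ((B - M c : ℝ) : ℂ) := by
    have h0 : ∑ c, Ψ c * (B : ℂ) = 0 := by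
      rw [← Finset.sum_mul, AddChar.sum_eq_zero_of_ne_one hΨ, zero_mul]
    rw [hK]
    push_cast
    simp only [mul_sub, Finset.sum_sub_distrib, h0]
    ring
  have hn : q * ‖kloostermanSum Ψ b‖ ≤ q * (3 * p * p ^ k + 1) := by
    calc q * ‖kloostermanSum Ψ b‖ = ‖(q : ℂ) * kloostermanSum Ψ b‖ := by
          rw [norm_mul, Complex.norm_real, Real.norm_of_nonneg hq0.le]
      _ ≤ ∑ c, (B - M c) := by
          rw [hK', norm_neg]
          refine (norm_sum_le _ _).trans (Finset.sum_le_sum fun c _ => ?_)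
          rw [norm_mul, AddChar.norm_apply, one_mul, Complex.norm_real, Real.norm_of_nonneg]
          linarith [hMB c]
      _ = q * (3 * p * p ^ k + 1) := by
          rw [Finset.sum_sub_distrib, hsumM]
          simp [← hqdef, hB]
          ring
  exact le_of_mul_le_mul_left hn hq0

end Kloosterman

section QuadraticExtension

open Polynomial

variable {F E : Type*} [Field F] [Fintype F] [Field E] [Fintype E] [Algebra F E]

theorem algebraMap_trace_of_finrank_two (h : Module.finrank F E = 2) (z : E) :
    algebraMap F E (Algebra.trace F E z) = z + z ^ Fintype.card F := by
  rw [FiniteField.algebraMap_trace_eq_sum_pow, h]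
  simp [Finset.sum_range_succ]

theorem algebraMap_norm_of_finrank_two (h : Module.finrank F E = 2) (z : E) :
    algebraMap F E (Algebra.norm F z) = z * z ^ Fintype.card F := by
  rw [FiniteField.algebraMap_norm_eq_prod_pow, h]
  simp [Finset.prod_range_succ]

theorem exists_sq_eq_algebraMap (hE : Module.finrank F E = 2) (h2 : ringChar F ≠ 2) {D : F}
    (hD : ¬ IsSquare D) :
    ∃ δ : E, δ ^ 2 = algebraMap F E D ∧ δ ^ Fintype.card F = - δ := by
  have hD0 : D ≠ 0 := by rintro rfl; exact hD (IsSquare.zero)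
  have hodd : Fintype.card F % 2 = 1 := FiniteField.odd_card_of_char_ne_two h2
  have hcard : Fintype.card E = Fintype.card F ^ 2 := by
    rw [← hE]; exact Module.card_eq_pow_finrank
  have hrE : ringChar E ≠ 2 := by
    rwa [← Algebra.ringChar_eq F E]
  have hsq : IsSquare (algebraMap F E D) := by
    rw [FiniteField.isSquare_iff hrE (by simpa using hD0), ← map_pow, hcard]
    have : Fintype.card F ^ 2 / 2 = (Fintype.card F - 1) * ((Fintype.card F + 1) / 2) := by
      obtain ⟨m, hm⟩ : ∃ m, Fintype.card F = 2 * m + 1 := ⟨Fintype.card F / 2, by omega⟩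
      rw [hm, show (2 * m + 1 + 1) / 2 = m + 1 by omega, Nat.add_sub_cancel,
        show (2 * m + 1) ^ 2 = 2 * (2 * m * (m + 1)) + 1 by ring]
      omega
    rw [this, pow_mul, FiniteField.pow_card_sub_one_eq_one D hD0, one_pow, map_one]
  obtain ⟨δ, hδ⟩ := hsq
  refine ⟨δ, by rw [hδ, pow_two], ?_⟩
  have hneg : D ^ (Fintype.card F / 2) = -1 :=
    (FiniteField.pow_dichotomy h2 hD0).resolve_left
      fun h => hD ((FiniteField.isSquare_iff h2 hD0).2 h)
  calc δ ^ Fintype.card F = δ ^ (2 * (Fintype.card F / 2) + 1) := by congr 1; omega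
    _ = - δ := by
      rw [pow_succ, pow_mul, pow_two, ← hδ, ← map_pow, hneg, map_neg, map_one, neg_one_mul]

variable [DecidableEq F] [DecidableEq E]

theorem card_trace_norm_add_card_add_mul (hE : Module.finrank F E = 2) (h2 : ringChar F ≠ 2)
    (s n : F) :
    (Finset.univ.filter fun z : E => (Algebra.trace F E z, Algebra.norm F z) = (s, n)).card
      + (Finset.univ.filter fun x : F × F => (x.1 + x.2, x.1 * x.2) = (s, n)).card = 2 := by
  have h2' : (2 : F) ≠ 0 := Ring.two_ne_zero h2
  have h2E : (2 : E) ≠ 0 := by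
    rw [← map_ofNat (algebraMap F E) 2]
    exact (map_ne_zero (algebraMap F E)).2 h2'
  have hinj := (algebraMap F E).injective
  have hfrobadd : ∀ x y : E, (x + y) ^ Fintype.card F = x ^ Fintype.card F + y ^ Fintype.card F :=
    fun x y => map_add (FiniteField.frobeniusAlgHom F E) x y
  have hfrobmul : ∀ (x : F) (y : E), (algebraMap F E x * y) ^ Fintype.card F
      = algebraMap F E x * y ^ Fintype.card F := fun x y => by
    rw [mul_pow, ← map_pow, FiniteField.pow_card]
  set D := s ^ 2 - 4 * n with hD
  have hE' : (Finset.univ.filter fun z : E => (Algebra.trace F E z, Algebra.norm F z) = (s, n)).card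
      = (Finset.univ.filter fun w : E =>
        w ^ 2 = algebraMap F E D ∧ w ^ Fintype.card F = - w).card := by
    refine Finset.card_bij' (fun z _ => 2 * z - algebraMap F E s)
      (fun w _ => algebraMap F E (1 / 2) * (w + algebraMap F E s)) ?_ ?_ ?_ ?_
    · intro z hz
      simp only [Finset.mem_filter, Finset.mem_univ, true_and, Prod.mk.injEq] at hz ⊢
      have ht := algebraMap_trace_of_finrank_two hE z
      have hn := algebraMap_norm_of_finrank_two hE z
      rw [hz.1] at ht
      rw [hz.2] at hn
      constructor
      · rw [hD, map_sub, map_pow, map_mul, hn, ht, map_ofNat]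
        ring
      · have := hfrobadd (algebraMap F E 2 * z) (algebraMap F E (-s) * 1)
        rw [hfrobmul, hfrobmul, one_pow, mul_one, map_neg, map_ofNat, ← sub_eq_add_neg] at this
        rw [this]
        linear_combination (-2) * ht
    · intro w hw
      simp only [Finset.mem_filter, Finset.mem_univ, true_and, Prod.mk.injEq] at hw ⊢
      have e : (algebraMap F E (1 / 2) * (w + algebraMap F E s)) ^ Fintype.card F
          = algebraMap F E (1 / 2) * (- w + algebraMap F E s) := by
        rw [hfrobmul, hfrobadd, hw.2, ← map_pow, FiniteField.pow_card]
      constructor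
      · apply hinj
        rw [algebraMap_trace_of_finrank_two hE, e, map_div₀, map_one, map_ofNat]
        field_simp
        ring
      · apply hinj
        rw [algebraMap_norm_of_finrank_two hE, e, map_div₀, map_one, map_ofNat]
        have := hw.1
        rw [hD, map_sub, map_pow, map_mul, map_ofNat] at this
        field_simp
        linear_combination - this
    · intro z _
      simp only [map_div₀, map_one, map_ofNat]
      field_simp
      ring
    · intro w _
      simp only [map_div₀, map_one, map_ofNat]
      field_simp
      ring
  have hF' : (Finset.univ.filter fun x : F × F => (x.1 + x.2, x.1 * x.2) = (s, n)).card
      = (Finset.univ.filter fun d : F => d ^ 2 = D).card := by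
    refine Finset.card_bij' (fun x _ => x.1 - x.2)
      (fun d _ => ((s + d) / 2, (s - d) / 2)) ?_ ?_ ?_ ?_
    · intro x hx
      simp only [Finset.mem_filter, Finset.mem_univ, true_and, Prod.mk.injEq] at hx ⊢
      rw [hD, ← hx.1, ← hx.2]
      ring
    · intro d hd
      simp only [Finset.mem_filter, Finset.mem_univ, true_and, Prod.mk.injEq] at hd ⊢
      constructor
      · field_simp
        ring
      · have h4 : (4 : F) ≠ 0 := by
          rw [show (4 : F) = 2 * 2 by norm_num]; exact mul_ne_zero h2' h2'
        rw [div_mul_div_comm, show (2 : F) * 2 = 4 by norm_num, div_eq_iff h4]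
        linear_combination - hd
    · intro x hx
      simp only [Finset.mem_filter, Finset.mem_univ, true_and, Prod.mk.injEq] at hx
      ext
      · simp only [← hx.1]
        field_simp
        ring
      · simp only [← hx.1]
        field_simp
        ring
    · intro d _
      simp only
      field_simp
      ring
  rw [hE', hF']
  by_cases hsq : IsSquare D
  · obtain ⟨d, hd⟩ := hsq
    have hroot : ∀ w : E, w ^ 2 = algebraMap F E D →
        w = algebraMap F E d ∨ w = algebraMap F E (-d) := fun w hw => by
      rw [hd, ← pow_two, map_pow, sq_eq_sq_iff_eq_or_eq_neg] at hw
      simpa using hw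
    have hfix : ∀ w : E, w ^ 2 = algebraMap F E D → w ^ Fintype.card F = w := fun w hw => by
      rcases hroot w hw with rfl | rfl <;> rw [← map_pow, FiniteField.pow_card]
    have hneg : ∀ w : E, w = - w → w = 0 := fun w hw => by
      have : 2 * w = 0 := by linear_combination hw
      exact (mul_eq_zero.1 this).resolve_left h2E
    have hset : (Finset.univ.filter fun e : F => e ^ 2 = D) = {d, -d} := by
      ext e
      simp only [Finset.mem_filter, Finset.mem_univ, true_and, Finset.mem_insert,
        Finset.mem_singleton]
      rw [hd, ← pow_two, sq_eq_sq_iff_eq_or_eq_neg]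
    rw [hset]
    by_cases hd0 : d = 0
    · subst hd0
      have : (Finset.univ.filter fun w : E =>
          w ^ 2 = algebraMap F E D ∧ w ^ Fintype.card F = - w) = {0} := by
        ext w
        simp only [Finset.mem_filter, Finset.mem_univ, true_and, Finset.mem_singleton]
        constructor
        · rintro ⟨h, -⟩
          simpa using hroot w h
        · rintro rfl
          simp [hd]
      rw [this]
      simp
    · have : (Finset.univ.filter fun w : E =>
          w ^ 2 = algebraMap F E D ∧ w ^ Fintype.card F = - w) = ∅ := by
        rw [Finset.filter_eq_empty_iff]
        rintro w - ⟨h, h'⟩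
        have hw0 := hneg w (by rw [← h', hfix w h])
        rw [hw0, hd] at h
        apply hd0
        simpa using h
      rw [this, Finset.card_empty, zero_add, Finset.card_pair]
      intro h
      have : 2 * d = 0 := by linear_combination h
      exact hd0 ((mul_eq_zero.1 this).resolve_left h2')
  · obtain ⟨δ, hδ, hδq⟩ := exists_sq_eq_algebraMap (E := E) hE h2 hsq
    have h1 : (Finset.univ.filter fun e : F => e ^ 2 = D) = ∅ := by
      rw [Finset.filter_eq_empty_iff]
      rintro e - h
      exact hsq ⟨e, by rw [← h, pow_two]⟩
    have h3 : (Finset.univ.filter fun w : E =>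
        w ^ 2 = algebraMap F E D ∧ w ^ Fintype.card F = - w) = {δ, -δ} := by
      ext w
      simp only [Finset.mem_filter, Finset.mem_univ, true_and, Finset.mem_insert,
        Finset.mem_singleton]
      rw [← hδ, sq_eq_sq_iff_eq_or_eq_neg]
      constructor
      · exact fun h => h.1
      · intro h
        refine ⟨h, ?_⟩
        have hodd : Odd (Fintype.card F) :=
          Nat.odd_iff.2 (FiniteField.odd_card_of_char_ne_two h2)
        rcases h with rfl | rfl
        · exact hδq
        · rw [hodd.neg_pow, hδq]
    rw [h1, h3, Finset.card_empty, add_zero, Finset.card_pair]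
    intro h
    have h4 : 2 * δ = 0 := by linear_combination h
    have h5 : δ = 0 := (mul_eq_zero.1 h4).resolve_left h2E
    rw [h5] at hδ
    apply hsq
    have : D = 0 := by simpa using hδ.symm
    rw [this]
    exact IsSquare.zero

/-- The additive character of a finite extension obtained by composing with the trace. -/
noncomputable def traceChar (E : Type*) [Field E] [Algebra F E] (Ψ : AddChar F ℂ) : AddChar E ℂ :=
  Ψ.compAddMonoidHom (Algebra.trace F E).toAddMonoidHom

omit [Fintype F] [DecidableEq F] [Fintype E] [DecidableEq E] in
theorem traceChar_apply (Ψ : AddChar F ℂ) (z : E) : traceChar E Ψ z = Ψ (Algebra.trace F E z) := rfl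

theorem kloostermanSum_traceChar (hE : Module.finrank F E = 2) (h2 : ringChar F ≠ 2)
    {Ψ : AddChar F ℂ} (hΨ : Ψ ≠ 1) {b : F} (hb : b ≠ 0) :
    kloostermanSum (traceChar E Ψ) (algebraMap F E b) + kloostermanSum Ψ b ^ 2
      = 2 * Fintype.card F := by
  set G : F × F → ℂ := fun y => Ψ (y.1 * (1 + b / y.2)) with hG
  set S : Finset (F × F) := Finset.univ.filter fun y => y.2 ≠ 0 with hS
  have hKE : kloostermanSum (traceChar E Ψ) (algebraMap F E b) = ∑ y ∈ S,
      ((Finset.univ.filter fun z : E => (Algebra.trace F E z, Algebra.norm F z) = y).card : ℂ)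
        * G y := by
    rw [kloostermanSum]
    have hterm : ∀ z ∈ ({0}ᶜ : Finset E), traceChar E Ψ (z + algebraMap F E b / z)
        = G (Algebra.trace F E z, Algebra.norm F z) := by
      intro z hz
      have hz0 : z ≠ 0 := by simpa using hz
      have hn0 : Algebra.norm F z ≠ 0 := Algebra.norm_ne_zero_iff.2 hz0
      rw [traceChar_apply, hG]
      congr 1
      apply (algebraMap F E).injective
      rw [algebraMap_trace_of_finrank_two hE, map_mul, map_add, map_div₀, map_one,
        algebraMap_trace_of_finrank_two hE, algebraMap_norm_of_finrank_two hE]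
      have hadd := map_add (FiniteField.frobeniusAlgHom F E) z (algebraMap F E b / z)
      simp only [FiniteField.coe_frobeniusAlgHom] at hadd
      rw [hadd, div_pow, ← map_pow, FiniteField.pow_card]
      field_simp
      ring
    rw [Finset.sum_congr rfl hterm, ← Finset.sum_fiberwise_of_maps_to (t := S)
      (g := fun z => (Algebra.trace F E z, Algebra.norm F z))]
    · refine Finset.sum_congr rfl fun y hy => ?_
      have hset : (({0}ᶜ : Finset E).filter fun z => (Algebra.trace F E z, Algebra.norm F z) = y)
          = Finset.univ.filter fun z : E => (Algebra.trace F E z, Algebra.norm F z) = y := by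
        ext z
        simp only [Finset.mem_filter, Finset.mem_univ, true_and, Finset.mem_compl,
          Finset.mem_singleton, and_iff_right_iff_imp]
        rintro rfl rfl
        simp [hS] at hy
      rw [hset, ← nsmul_eq_mul, ← Finset.sum_const]
      exact Finset.sum_congr rfl fun z hz => by rw [(Finset.mem_filter.1 hz).2]
    · intro z hz
      simpa [hS] using hz
  have hKF : kloostermanSum Ψ b ^ 2 = ∑ y ∈ S,
      ((Finset.univ.filter fun x : F × F => (x.1 + x.2, x.1 * x.2) = y).card : ℂ) * G y := by
    rw [kloostermanSum, pow_two, Finset.sum_mul_sum, ← Finset.sum_product']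
    have hterm : ∀ x ∈ ({0}ᶜ : Finset F) ×ˢ ({0}ᶜ : Finset F),
        Ψ (x.1 + b / x.1) * Ψ (x.2 + b / x.2) = G (x.1 + x.2, x.1 * x.2) := by
      intro x hx
      obtain ⟨h1, h2⟩ : x.1 ≠ 0 ∧ x.2 ≠ 0 := by simpa using hx
      rw [← AddChar.map_add_eq_mul, hG]
      congr 1
      simp only
      field_simp
      ring
    rw [Finset.sum_congr rfl hterm, ← Finset.sum_fiberwise_of_maps_to (t := S)
      (g := fun x => (x.1 + x.2, x.1 * x.2))]
    · refine Finset.sum_congr rfl fun y hy => ?_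
      have hset : ((({0}ᶜ : Finset F) ×ˢ ({0}ᶜ : Finset F)).filter
          fun x => (x.1 + x.2, x.1 * x.2) = y)
          = Finset.univ.filter fun x : F × F => (x.1 + x.2, x.1 * x.2) = y := by
        ext x
        simp only [Finset.mem_filter, Finset.mem_univ, true_and, Finset.mem_compl,
          Finset.mem_singleton, and_iff_right_iff_imp, Finset.mem_product]
        rintro rfl
        simpa [hS] using hy
      rw [hset, ← nsmul_eq_mul, ← Finset.sum_const]
      exact Finset.sum_congr rfl fun z hz => by rw [(Finset.mem_filter.1 hz).2]
    · intro x hx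
      simpa [hS] using hx
  rw [hKE, hKF, ← Finset.sum_add_distrib]
  have hterm : ∀ y ∈ S, ((Finset.univ.filter fun z : E =>
      (Algebra.trace F E z, Algebra.norm F z) = y).card : ℂ) * G y
      + ((Finset.univ.filter fun x : F × F => (x.1 + x.2, x.1 * x.2) = y).card : ℂ) * G y
      = 2 * G y := fun y _ => by
    rw [← add_mul]
    congr 1
    exact_mod_cast card_trace_norm_add_card_add_mul (E := E) hE h2 y.1 y.2
  rw [Finset.sum_congr rfl hterm, ← Finset.mul_sum]
  congr 1
  have hSprod : S = Finset.univ ×ˢ ({0}ᶜ : Finset F) := by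
    ext y
    simp [hS]
  rw [hSprod, Finset.sum_product_right]
  have hinner : ∀ n : F, ∑ s : F, G (s, n) = if 1 + b / n = 0 then (Fintype.card F : ℂ) else 0 := by
    intro n
    simp only [hG]
    rw [AddChar.sum_mulShift _ (AddChar.IsPrimitive.of_ne_one hΨ)]
    split_ifs <;> simp
  simp only [hinner]
  rw [Finset.sum_eq_single (-b)]
  · rw [if_pos]
    rw [div_neg, div_self hb, add_neg_cancel]
  · intro n hn hnb
    have hn0 : n ≠ 0 := by simpa using hn
    rw [if_neg]
    intro h
    apply hnb
    field_simp at h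
    linear_combination h
  · intro h
    simp [hb] at h

end QuadraticExtension

section Weil

theorem exists_extension_kloostermanSum_ge (p : ℕ) [Fact p.Prime] (hp2 : p ≠ 2)
    {Ψ : AddChar (ZMod p) ℂ} (hΨ : Ψ ≠ 1) {b : ZMod p} (hb : b ≠ 0) {δ : ℝ} (hδ : 0 ≤ δ)
    (h : (2 + δ) * √p ≤ ‖kloostermanSum Ψ b‖) (n : ℕ) :
    ∃ (E : Type) (_ : Field E) (_ : Fintype E) (_ : DecidableEq E) (_ : CharP E p)
      (Φ : AddChar E ℂ) (c : E), Fintype.card E = p ^ 2 ^ n ∧ Φ ≠ 1 ∧ (∀ t, Φ (t ^ p) = Φ t) ∧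
        c ≠ 0 ∧ (2 + 4 ^ n * δ) * √(p ^ 2 ^ n : ℕ) ≤ ‖kloostermanSum Φ c‖ := by
  induction n with
  | zero =>
    refine ⟨ZMod p, inferInstance, inferInstance, inferInstance, inferInstance, Ψ, b, ?_, hΨ, ?_,
      hb, ?_⟩
    · simp [ZMod.card]
    · simp [ZMod.pow_card]
    · simpa using h
  | succ n ih =>
    obtain ⟨F, _, _, _, _, Φ, c, hcard, hΦ, hΦp, hc, hK⟩ := ih
    set E := FiniteField.Extension F p 2 with hE
    have hfin : Module.finrank F E = 2 := FiniteField.finrank_extension F p 2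
    have : Finite E := Module.finite_of_finite F
    classical
    let _ : Fintype E := Fintype.ofFinite E
    have hchar : CharP E p := charP_of_injective_algebraMap (algebraMap F E).injective p
    have hcardE : Fintype.card E = (p ^ 2 ^ n) ^ 2 := by
      rw [← hcard, ← hfin]; exact Module.card_eq_pow_finrank
    have h2 : ringChar F ≠ 2 := by rwa [ringChar.eq F p]
    have hrec := kloostermanSum_traceChar (E := E) hfin h2 hΦ hc
    refine ⟨E, inferInstance, inferInstance, inferInstance, hchar, traceChar E Φ,
      algebraMap F E c, ?_, ?_, ?_, ?_, ?_⟩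
    · rw [hcardE, ← pow_mul, pow_succ]
    · obtain ⟨x, hx⟩ := AddChar.ne_one_iff.1 hΦ
      obtain ⟨z, rfl⟩ := Algebra.trace_surjective F E x
      exact AddChar.ne_one_iff.2 ⟨z, hx⟩
    · intro t
      rw [traceChar_apply, traceChar_apply, ← hΦp (Algebra.trace F E t)]
      congr 1
      apply (algebraMap F E).injective
      rw [map_pow (algebraMap F E), algebraMap_trace_of_finrank_two hfin,
        algebraMap_trace_of_finrank_two hfin, add_pow_char, pow_right_comm]
    · simpa using hc
    · have hsqrt : √((p ^ 2 ^ (n + 1) : ℕ) : ℝ) = Fintype.card F := by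
        rw [hcard, pow_succ, pow_mul]
        push_cast
        exact Real.sqrt_sq (by positivity)
      rw [hsqrt]
      set q : ℝ := (Fintype.card F : ℝ) with hq
      rw [← hcard] at hK
      have hKE : kloostermanSum (traceChar E Φ) (algebraMap F E c)
          = 2 * (q : ℂ) - kloostermanSum Φ c ^ 2 := by
        rw [hq]
        push_cast
        linear_combination hrec
      have h1 : ‖kloostermanSum Φ c‖ ^ 2 - 2 * q
          ≤ ‖kloostermanSum (traceChar E Φ) (algebraMap F E c)‖ := by
        rw [hKE, norm_sub_rev]
        refine le_trans (le_of_eq ?_) (norm_sub_norm_le _ _)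
        rw [norm_pow, norm_mul, Complex.norm_real, Real.norm_of_nonneg (by positivity)]
        norm_num
      refine le_trans ?_ h1
      have h0 : 0 ≤ 4 ^ n * δ := by positivity
      have h2 : ((2 + 4 ^ n * δ) * √q) ^ 2 ≤ ‖kloostermanSum Φ c‖ ^ 2 :=
        pow_le_pow_left₀ (by positivity) hK 2
      rw [mul_pow, Real.sq_sqrt (by positivity)] at h2
      have hq0 : 0 ≤ q := by positivity
      rw [pow_succ]
      nlinarith [mul_nonneg (sq_nonneg (4 ^ n * δ)) hq0]

/-- **Weil's bound** for Kloosterman sums modulo an odd prime. -/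
theorem norm_kloostermanSum_le (p : ℕ) [Fact p.Prime] (hp2 : p ≠ 2)
    {Ψ : AddChar (ZMod p) ℂ} (hΨ : Ψ ≠ 1) {b : ZMod p} (hb : b ≠ 0) :
    ‖kloostermanSum Ψ b‖ ≤ 2 * √p := by
  by_contra! hlt
  have hp : p.Prime := Fact.out
  have hp0 : 0 < √(p : ℝ) := Real.sqrt_pos.2 (by exact_mod_cast hp.pos)
  obtain ⟨δ, hδ, h⟩ : ∃ δ : ℝ, 0 < δ ∧ (2 + δ) * √p ≤ ‖kloostermanSum Ψ b‖ := by
    refine ⟨‖kloostermanSum Ψ b‖ / √p - 2, ?_, ?_⟩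
    · rw [sub_pos, lt_div_iff₀ hp0]
      exact hlt
    · rw [add_sub_cancel, div_mul_cancel₀ _ hp0.ne']
  obtain ⟨m, hm⟩ := pow_unbounded_of_one_lt ((3 * p + 1) / δ) (by norm_num : (1 : ℝ) < 4)
  obtain ⟨E, _, _, _, _, Φ, c, hcard, hΦ, hΦp, hc, hK⟩ :=
    exists_extension_kloostermanSum_ge p hp2 hΨ hb hδ.le h (m + 3)
  have hpk : p ^ 2 + 2 * p < p ^ 2 ^ (m + 2) := by
    have h2 := hp.two_le
    have h4 : 4 ≤ 2 ^ (m + 2) := by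
      rw [pow_add]
      have := Nat.one_le_two_pow (n := m)
      omega
    calc p ^ 2 + 2 * p < p ^ 4 := by nlinarith [pow_pos hp.pos 2, pow_pos hp.pos 3]
      _ ≤ p ^ 2 ^ (m + 2) := Nat.pow_le_pow_right hp.pos h4
  have hcard' : Fintype.card E = (p ^ 2 ^ (m + 2)) ^ 2 := by
    rw [hcard, ← pow_mul, ← pow_succ]
  have hS := norm_kloostermanSum_le_of_card_eq p hp2 hcard' hpk hc hΦ hΦp
  have hsqrt : √((p ^ 2 ^ (m + 3) : ℕ) : ℝ) = (p : ℝ) ^ 2 ^ (m + 2) := by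
    rw [pow_succ, pow_mul]
    push_cast
    exact Real.sqrt_sq (by positivity)
  rw [hsqrt] at hK
  set P : ℝ := (p : ℝ) ^ 2 ^ (m + 2)
  have hP : 1 ≤ P := one_le_pow₀ (by exact_mod_cast hp.one_lt.le)
  rw [div_lt_iff₀ hδ] at hm
  have hm' : (4 : ℝ) ^ m * δ ≤ 4 ^ (m + 3) * δ := by
    apply mul_le_mul_of_nonneg_right _ hδ.le
    exact pow_le_pow_right₀ (by norm_num) (by omega)
  have : (2 + 4 ^ (m + 3) * δ) * P ≤ (3 * p + 1) * P := by linarith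
  have := le_of_mul_le_mul_right this (by linarith)
  linarith

end Weil

section Completion

variable {p : ℕ} [Fact p.Prime]

/-- The deviation of the indicator of `x * y = a` from its mean over pairs of units. -/
noncomputable def hyperbolaDeviation (a x y : ZMod p) : ℝ :=
  (if x * y = a then 1 else 0) - (1 / ((p : ℝ) - 1)) * (if x ≠ 0 ∧ y ≠ 0 then 1 else 0)

theorem hyperbolaDeviation_comm (a x y : ZMod p) :
    hyperbolaDeviation a x y = hyperbolaDeviation a y x := by
  simp only [hyperbolaDeviation, mul_comm x y, and_comm]

theorem norm_kloostermanSum_le_two_mul_sqrt {Ψ : AddChar (ZMod p) ℂ} (hΨ : Ψ ≠ 1) {b : ZMod p}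
    (hb : b ≠ 0) : ‖kloostermanSum Ψ b‖ ≤ 2 * √p := by
  by_cases hp2 : p = 2
  · subst hp2
    have h1 : ‖kloostermanSum Ψ b‖ ≤ ∑ x ∈ ({0}ᶜ : Finset (ZMod 2)), 1 := by
      refine (norm_sum_le _ _).trans (Finset.sum_le_sum fun x _ => ?_)
      rw [AddChar.norm_apply]
    have h2 : (∑ x ∈ ({0}ᶜ : Finset (ZMod 2)), (1 : ℝ)) = 1 := by
      rw [Finset.sum_const, Finset.card_compl, Finset.card_singleton, ZMod.card]
      norm_num
    have h3 : (1 : ℝ) ≤ √(2 : ℕ) := Real.one_le_sqrt.2 (by norm_num)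
    linarith
  · exact norm_kloostermanSum_le p hp2 hΨ hb

theorem sum_compl_stdAddChar (k : ZMod p) :
    ∑ y ∈ ({0}ᶜ : Finset (ZMod p)), ZMod.stdAddChar (k * y) = if k = 0 then (p : ℂ) - 1 else -1 := by
  have h := AddChar.sum_mulShift k (ZMod.isPrimitive_stdAddChar p)
  rw [← Finset.sum_add_sum_compl {0}] at h
  simp only [Finset.sum_singleton, zero_mul, AddChar.map_zero_eq_one, ZMod.card] at h
  simp only [mul_comm k]
  split_ifs at h ⊢ with h0
  · linear_combination h
  · push_cast at h
    linear_combination h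

theorem sum_compl_stdAddChar_div (k : ZMod p) :
    ∑ y ∈ ({0}ᶜ : Finset (ZMod p)), ZMod.stdAddChar (k / y)
      = ∑ y ∈ ({0}ᶜ : Finset (ZMod p)), ZMod.stdAddChar (k * y) :=
  Finset.sum_bij' (fun y _ => y⁻¹) (fun y _ => y⁻¹) (by simp) (by simp) (by simp) (by simp)
    (by simp [div_eq_mul_inv])

theorem sum_hyperbolaDeviation_mul {a : ZMod p} (ha : a ≠ 0) (h k : ZMod p) :
    ∑ x, ∑ y, (hyperbolaDeviation a x y : ℂ) * ZMod.stdAddChar (h * x + k * y) =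
      ∑ x ∈ ({0}ᶜ : Finset (ZMod p)), ZMod.stdAddChar (h * x + k * a / x) -
        (1 / ((p : ℂ) - 1)) * (∑ x ∈ ({0}ᶜ : Finset (ZMod p)), ZMod.stdAddChar (h * x)) *
          ∑ x ∈ ({0}ᶜ : Finset (ZMod p)), ZMod.stdAddChar (k * x) := by
  rw [← Finset.sum_add_sum_compl {0}, Finset.sum_singleton]
  have h0 : ∀ y : ZMod p, hyperbolaDeviation a 0 y = 0 := fun y => by
    simp [hyperbolaDeviation, ha.symm]
  simp only [h0, Complex.ofReal_zero, zero_mul, Finset.sum_const_zero, zero_add]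
  rw [mul_assoc, Finset.sum_mul_sum, Finset.mul_sum, ← Finset.sum_sub_distrib]
  refine Finset.sum_congr rfl fun x hx => ?_
  have hx0 : x ≠ 0 := by simpa using hx
  have hxy : ∀ y, x * y = a ↔ y = a / x := fun y => by
    rw [eq_div_iff hx0, mul_comm]
  have hterm : ∀ y, (hyperbolaDeviation a x y : ℂ) * ZMod.stdAddChar (h * x + k * y)
      = (if y = a / x then ZMod.stdAddChar (h * x + k * y) else 0) - (1 / ((p : ℂ) - 1)) *
        (if y ∈ ({0}ᶜ : Finset (ZMod p)) then ZMod.stdAddChar (h * x) * ZMod.stdAddChar (k * y)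
          else 0) := by
    intro y
    rw [← AddChar.map_add_eq_mul]
    simp only [hyperbolaDeviation, hxy, Finset.mem_compl, Finset.mem_singleton]
    push_cast
    split_ifs <;> simp_all
    ring
  simp only [hterm]
  rw [Finset.sum_sub_distrib, ← Finset.mul_sum, Finset.sum_ite_mem, Finset.univ_inter]
  simp [mul_div_assoc]

theorem norm_sum_hyperbolaDeviation_mul_le {a : ZMod p} (ha : a ≠ 0) (h k : ZMod p) :
    ‖∑ x, ∑ y, (hyperbolaDeviation a x y : ℂ) * ZMod.stdAddChar (h * x + k * y)‖
      ≤ if h = 0 ∨ k = 0 then 0 else 2 * √p + 1 := by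
  have hp : (p : ℂ) - 1 ≠ 0 := by
    rw [sub_ne_zero]
    exact_mod_cast (Fact.out : p.Prime).one_lt.ne'
  rw [sum_hyperbolaDeviation_mul ha, sum_compl_stdAddChar, sum_compl_stdAddChar]
  by_cases h1 : h = 0
  · rw [if_pos h1, if_pos (Or.inl h1)]
    simp only [h1, zero_mul, zero_add]
    rw [sum_compl_stdAddChar_div, sum_compl_stdAddChar]
    by_cases h2 : k = 0
    · simp [h2, hp]
    · rw [if_neg (mul_ne_zero h2 ha), if_neg h2]
      simp [hp]
  by_cases h2 : k = 0
  · rw [if_neg h1, if_pos h2, if_pos (Or.inr h2)]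
    simp only [h2, zero_mul, zero_div, add_zero]
    rw [sum_compl_stdAddChar, if_neg h1]
    simp [hp]
  · rw [if_neg h1, if_neg h2, if_neg (by tauto)]
    have hΨ : AddChar.mulShift (ZMod.stdAddChar (N := p)) h ≠ 1 :=
      ZMod.isPrimitive_stdAddChar p h1
    have hK := norm_kloostermanSum_le_two_mul_sqrt hΨ
      (div_ne_zero (mul_ne_zero h2 ha) h1)
    have hKeq : kloostermanSum (AddChar.mulShift (ZMod.stdAddChar (N := p)) h) (k * a / h)
        = ∑ x ∈ ({0}ᶜ : Finset (ZMod p)), ZMod.stdAddChar (h * x + k * a / x) := by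
      refine Finset.sum_congr rfl fun x hx => ?_
      have hx0 : x ≠ 0 := by simpa using hx
      rw [AddChar.mulShift_apply]
      congr 1
      field_simp
    rw [← hKeq]
    refine (norm_sub_le _ _).trans (add_le_add hK ?_)
    have h2 : (2 : ℝ) ≤ p := by exact_mod_cast (Fact.out : p.Prime).two_le
    have : (1 / ((p : ℂ) - 1)) * -1 * -1 = ((1 / ((p : ℝ) - 1) : ℝ) : ℂ) := by
      push_cast
      ring
    rw [this, Complex.norm_real, Real.norm_of_nonneg (by apply one_div_nonneg.2; linarith),
      div_le_one (by linarith)]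
    linarith

/-- Jordan's inequality in symmetric form. -/
theorem two_mul_mul_one_sub_le_sin {x : ℝ} (h0 : 0 ≤ x) (h1 : x ≤ 1) :
    2 * x * (1 - x) ≤ Real.sin (Real.pi * x) := by
  have key : ∀ y : ℝ, 0 ≤ y → y ≤ 1 / 2 → 2 * y * (1 - y) ≤ Real.sin (Real.pi * y) := by
    intro y hy0 hy1
    have h := Real.mul_le_sin (x := Real.pi * y) (by positivity) (by nlinarith [Real.pi_pos])
    have : 2 / Real.pi * (Real.pi * y) = 2 * y := by field_simp
    rw [this] at h
    nlinarith
  rcases le_total x (1 / 2) with h | h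
  · exact key x h0 h
  · have := key (1 - x) (by linarith) (by linarith)
    rw [show Real.pi * (1 - x) = Real.pi - Real.pi * x by ring, Real.sin_pi_sub] at this
    linarith

theorem norm_sum_Ico_stdAddChar_le {h : ZMod p} (hh : h ≠ 0) (u v : ℕ) :
    ‖∑ m ∈ Finset.Ico u v, ZMod.stdAddChar (h * (m : ZMod p))‖
      ≤ p / 2 * (1 / (h.val : ℝ) + 1 / ((p : ℝ) - h.val)) := by
  have hp0 : 0 < (p : ℝ) := by exact_mod_cast (Fact.out : p.Prime).pos
  have hv0 : 0 < (h.val : ℝ) := by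
    exact_mod_cast Nat.pos_of_ne_zero ((ZMod.val_ne_zero h).2 hh)
  have hvp : (h.val : ℝ) < p := by exact_mod_cast ZMod.val_lt h
  have hpos : 0 ≤ (p : ℝ) / 2 * (1 / (h.val : ℝ) + 1 / ((p : ℝ) - h.val)) := by
    have : 0 < (p : ℝ) - h.val := by linarith
    positivity
  rcases le_total v u with huv | huv
  · simpa [Finset.Ico_eq_empty_of_le huv] using hpos
  set z : ℂ := ZMod.stdAddChar h with hz
  have hterm : ∀ m : ℕ, ZMod.stdAddChar (h * (m : ZMod p)) = z ^ m := fun m => by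
    rw [hz, ← AddChar.map_nsmul_eq_pow, nsmul_eq_mul, mul_comm]
  have hz1 : ‖z‖ = 1 := AddChar.norm_apply _ _
  set x : ℝ := h.val / p with hx
  have hx0 : 0 < x := by positivity
  have hx1 : x < 1 := (div_lt_one hp0).2 hvp
  have hzexp : z = Complex.exp (Complex.I * ((2 * (Real.pi * x) : ℝ) : ℂ)) := by
    have h1 := ZMod.stdAddChar_coe (N := p) (h.val : ℤ)
    rw [Int.cast_natCast, ZMod.natCast_zmod_val] at h1
    rw [hz, h1, hx]
    congr 1
    push_cast
    ring
  have hsin := two_mul_mul_one_sub_le_sin hx0.le hx1.le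
  have hden : 4 * x * (1 - x) ≤ ‖z - 1‖ := by
    rw [hzexp, Complex.norm_exp_I_mul_ofReal_sub_one, mul_div_cancel_left₀ _ two_ne_zero, norm_mul,
      Real.norm_eq_abs, Real.norm_eq_abs, abs_two]
    have := le_abs_self (Real.sin (Real.pi * x))
    linarith
  have hprod : ‖∑ m ∈ Finset.Ico u v, z ^ m‖ * ‖z - 1‖ ≤ 2 := by
    rw [← norm_mul, geom_sum_Ico_mul _ huv]
    refine (norm_sub_le _ _).trans ?_
    rw [norm_pow, norm_pow, hz1]
    norm_num
  simp only [hterm]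
  have hx2 : 0 < 1 - x := by linarith
  have hd0 : 0 < 4 * x * (1 - x) := by positivity
  have heq : (p : ℝ) / 2 * (1 / (h.val : ℝ) + 1 / ((p : ℝ) - h.val)) = 2 / (4 * x * (1 - x)) := by
    have h3 : (h.val : ℝ) = x * p := by rw [hx]; field_simp
    have h4 : (p : ℝ) - x * p = (1 - x) * p := by ring
    rw [h3, h4]
    field_simp
    ring
  rw [heq, le_div_iff₀ hd0]
  exact (mul_le_mul_of_nonneg_left hden (norm_nonneg _)).trans hprod

theorem sum_norm_sum_Ico_stdAddChar_le (u v : ℕ) :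
    ∑ h ∈ ({0}ᶜ : Finset (ZMod p)), ‖∑ m ∈ Finset.Ico u v, ZMod.stdAddChar (h * (m : ZMod p))‖
      ≤ p * (1 + Real.log p) := by
  have hp : p.Prime := Fact.out
  have hH : ∑ r ∈ Finset.Ico 1 p, 1 / (r : ℝ) ≤ 1 + Real.log p := by
    have h1 := harmonic_le_one_add_log (p - 1)
    have h2 : ((harmonic (p - 1) : ℚ) : ℝ) = ∑ r ∈ Finset.Ico 1 p, 1 / (r : ℝ) := by
      rw [harmonic_eq_sum_Icc]
      push_cast
      refine Finset.sum_congr ?_ fun r _ => by rw [one_div]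
      ext r
      simp only [Finset.mem_Icc, Finset.mem_Ico]
      have := hp.one_lt
      omega
    rw [← h2]
    refine h1.trans (add_le_add le_rfl (Real.log_le_log ?_ ?_))
    · exact_mod_cast Nat.sub_pos_of_lt hp.one_lt
    · exact_mod_cast Nat.sub_le _ _
  calc _ ≤ ∑ h ∈ ({0}ᶜ : Finset (ZMod p)), (p : ℝ) / 2 * (1 / (h.val : ℝ) + 1 / ((p : ℝ) - h.val)) :=
        Finset.sum_le_sum fun h hh => norm_sum_Ico_stdAddChar_le (by simpa using hh) u v
    _ = ∑ r ∈ Finset.Ico 1 p, (p : ℝ) / 2 * (1 / (r : ℝ) + 1 / ((p : ℝ) - r)) := by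
        refine Finset.sum_bij' (fun h _ => h.val) (fun r _ => (r : ZMod p)) ?_ ?_ ?_ ?_ ?_
        · intro h hh
          have hh0 : h ≠ 0 := by simpa using hh
          exact Finset.mem_Ico.2 ⟨Nat.pos_of_ne_zero ((ZMod.val_ne_zero h).2 hh0), ZMod.val_lt h⟩
        · intro r hr
          rw [Finset.mem_Ico] at hr
          simp only [Finset.mem_compl, Finset.mem_singleton]
          rw [ZMod.natCast_eq_zero_iff]
          exact Nat.not_dvd_of_pos_of_lt hr.1 hr.2
        · intro h _
          exact ZMod.natCast_zmod_val h
        · intro r hr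
          exact ZMod.val_cast_of_lt (Finset.mem_Ico.1 hr).2
        · intro h _
          rfl
    _ = (p : ℝ) / 2 * (∑ r ∈ Finset.Ico 1 p, 1 / (r : ℝ) + ∑ r ∈ Finset.Ico 1 p, 1 / (r : ℝ)) := by
        rw [← Finset.mul_sum, Finset.sum_add_distrib]
        congr 2
        refine Finset.sum_bij' (fun r _ => p - r) (fun r _ => p - r) ?_ ?_ ?_ ?_ ?_
        · intro r hr
          rw [Finset.mem_Ico] at hr ⊢
          omega
        · intro r hr
          rw [Finset.mem_Ico] at hr ⊢
          omega
        · intro r hr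
          rw [Finset.mem_Ico] at hr
          omega
        · intro r hr
          rw [Finset.mem_Ico] at hr
          omega
        · intro r hr
          rw [Finset.mem_Ico] at hr
          rw [Nat.cast_sub hr.2.le]
    _ ≤ p * (1 + Real.log p) := by
        have : (0 : ℝ) ≤ p := by positivity
        nlinarith

theorem sum_apply_natCast_eq (I : Finset ℕ) (Φ : ZMod p → ℂ) :
    ∑ m ∈ I, Φ (m : ZMod p) = (1 / (p : ℂ)) * ∑ h : ZMod p,
      (∑ m ∈ I, ZMod.stdAddChar (h * (m : ZMod p))) * ∑ x, Φ x * ZMod.stdAddChar (-h * x) := by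
  have hp : (p : ℂ) ≠ 0 := by exact_mod_cast (Fact.out : p.Prime).ne_zero
  have h1 : ∀ h : ZMod p, (∑ m ∈ I, ZMod.stdAddChar (h * (m : ZMod p))) *
      ∑ x, Φ x * ZMod.stdAddChar (-h * x)
      = ∑ m ∈ I, ∑ x, Φ x * ZMod.stdAddChar (h * ((m : ZMod p) - x)) := by
    intro h
    rw [Finset.sum_mul_sum]
    refine Finset.sum_congr rfl fun m _ => Finset.sum_congr rfl fun x _ => ?_
    rw [mul_left_comm, ← AddChar.map_add_eq_mul]
    congr 2
    ring
  simp only [h1]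
  rw [Finset.sum_comm, Finset.mul_sum]
  refine Finset.sum_congr rfl fun m _ => ?_
  rw [Finset.sum_comm]
  simp only [← Finset.mul_sum, AddChar.sum_mulShift _ (ZMod.isPrimitive_stdAddChar p), ZMod.card,
    sub_eq_zero]
  rw [Finset.sum_eq_single (m : ZMod p)]
  · rw [if_pos rfl]
    field_simp
  · intro x _ hx
    simp [Ne.symm hx]
  · simp

theorem abs_sum_hyperbolaDeviation_le {a : ZMod p} (ha : a ≠ 0) (u v u' v' : ℕ) :
    |∑ m ∈ Finset.Ico u v, ∑ n ∈ Finset.Ico u' v', hyperbolaDeviation a (m : ZMod p) (n : ZMod p)|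
      ≤ (2 * √p + 1) * (1 + Real.log p) ^ 2 := by
  have hp0 : 0 < (p : ℝ) := by exact_mod_cast (Fact.out : p.Prime).pos
  set S : ZMod p → ℂ := fun h => ∑ m ∈ Finset.Ico u v, ZMod.stdAddChar (h * (m : ZMod p)) with hS
  set S' : ZMod p → ℂ := fun h => ∑ m ∈ Finset.Ico u' v', ZMod.stdAddChar (h * (m : ZMod p)) with hS'
  set D : ZMod p → ZMod p → ℂ := fun h k =>
    ∑ x, ∑ y, (hyperbolaDeviation a x y : ℂ) * ZMod.stdAddChar (-h * x + -k * y) with hD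
  have hexp : ((∑ m ∈ Finset.Ico u v, ∑ n ∈ Finset.Ico u' v',
      hyperbolaDeviation a (m : ZMod p) (n : ZMod p) : ℝ) : ℂ)
      = (1 / (p : ℂ)) ^ 2 * ∑ h, ∑ k, S h * S' k * D h k := by
    push_cast
    rw [sum_apply_natCast_eq (Finset.Ico u v)
      (fun x => ∑ n ∈ Finset.Ico u' v', (hyperbolaDeviation a x (n : ZMod p) : ℂ)), pow_two,
      mul_assoc]
    congr 1
    rw [Finset.mul_sum]
    refine Finset.sum_congr rfl fun h _ => ?_
    have h1 : ∀ x : ZMod p, (∑ n ∈ Finset.Ico u' v', (hyperbolaDeviation a x (n : ZMod p) : ℂ))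
        = (1 / (p : ℂ)) * ∑ k, S' k * ∑ y, (hyperbolaDeviation a x y : ℂ) *
          ZMod.stdAddChar (-k * y) := fun x =>
      sum_apply_natCast_eq (Finset.Ico u' v') (fun y => (hyperbolaDeviation a x y : ℂ))
    simp only [h1, hD]
    change S h * _ = _
    simp only [Finset.mul_sum, Finset.sum_mul]
    rw [Finset.sum_comm]
    refine Finset.sum_congr rfl fun k _ => Finset.sum_congr rfl fun x _ =>
      Finset.sum_congr rfl fun y _ => ?_
    rw [AddChar.map_add_eq_mul]
    ring
  have hDle : ∀ h k, ‖S h * S' k * D h k‖ ≤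
      (if h ∈ ({0}ᶜ : Finset (ZMod p)) then if k ∈ ({0}ᶜ : Finset (ZMod p)) then
        ‖S h‖ * ‖S' k‖ * (2 * √p + 1) else 0 else 0) := by
    intro h k
    have h1 := norm_sum_hyperbolaDeviation_mul_le ha (-h) (-k)
    rw [norm_mul, norm_mul]
    change ‖D h k‖ ≤ _ at h1
    by_cases hh : h = 0
    · rw [if_pos (by simp [hh])] at h1
      rw [le_antisymm h1 (norm_nonneg _), mul_zero]
      simp [hh]
    by_cases hk : k = 0
    · rw [if_pos (by simp [hk])] at h1
      rw [le_antisymm h1 (norm_nonneg _), mul_zero]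
      simp [hk]
    rw [if_neg (by simp [hh, hk])] at h1
    simp only [Finset.mem_compl, Finset.mem_singleton, hh, hk, not_false_eq_true, if_true]
    gcongr
  have hsum : ‖∑ h, ∑ k, S h * S' k * D h k‖
      ≤ (p * (1 + Real.log p)) * (p * (1 + Real.log p)) * (2 * √p + 1) := by
    calc ‖∑ h, ∑ k, S h * S' k * D h k‖ ≤ ∑ h, ∑ k, ‖S h * S' k * D h k‖ :=
          (norm_sum_le _ _).trans (Finset.sum_le_sum fun h _ => norm_sum_le _ _)
      _ ≤ ∑ h ∈ ({0}ᶜ : Finset (ZMod p)), ∑ k ∈ ({0}ᶜ : Finset (ZMod p)),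
            ‖S h‖ * ‖S' k‖ * (2 * √p + 1) := by
          refine (Finset.sum_le_sum fun h _ => Finset.sum_le_sum fun k _ => hDle h k).trans
            (le_of_eq ?_)
          have h1 : ∀ h : ZMod p, (∑ k, if h ∈ ({0}ᶜ : Finset (ZMod p)) then
              if k ∈ ({0}ᶜ : Finset (ZMod p)) then ‖S h‖ * ‖S' k‖ * (2 * √p + 1) else 0 else 0)
              = if h ∈ ({0}ᶜ : Finset (ZMod p)) then ∑ k ∈ ({0}ᶜ : Finset (ZMod p)),
                ‖S h‖ * ‖S' k‖ * (2 * √p + 1) else 0 := by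
            intro h
            split_ifs
            · rw [Finset.sum_ite_mem, Finset.univ_inter]
            · simp
          simp only [h1]
          rw [Finset.sum_ite_mem, Finset.univ_inter]
      _ = (∑ h ∈ ({0}ᶜ : Finset (ZMod p)), ‖S h‖) * (∑ k ∈ ({0}ᶜ : Finset (ZMod p)), ‖S' k‖)
            * (2 * √p + 1) := by
          rw [Finset.sum_mul_sum, Finset.sum_mul]
          refine Finset.sum_congr rfl fun h _ => ?_
          rw [Finset.sum_mul]
      _ ≤ _ := by
          gcongr
          · exact sum_norm_sum_Ico_stdAddChar_le u v
          · exact sum_norm_sum_Ico_stdAddChar_le u' v'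
  rw [← Real.norm_eq_abs, ← Complex.norm_real, hexp, norm_mul]
  have hp2 : ‖(1 / (p : ℂ)) ^ 2‖ = 1 / (p : ℝ) ^ 2 := by simp
  rw [hp2]
  calc _ ≤ 1 / (p : ℝ) ^ 2 * ((p * (1 + Real.log p)) * (p * (1 + Real.log p)) * (2 * √p + 1)) := by
        gcongr
    _ = _ := by field_simp

end Completion

section Hyperbola

theorem sum_divisorsAntidiagonal_Icc_eq {f : ℕ → ℕ → ℝ} (hf : ∀ m n, f m n = f n m) (N : ℕ) :
    ∑ n ∈ Finset.Icc 1 N, ∑ x ∈ n.divisorsAntidiagonal, f x.1 x.2 =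
      2 * ∑ m ∈ Finset.Icc 1 N.sqrt, ∑ n ∈ Finset.Icc 1 (N / m), f m n -
        ∑ m ∈ Finset.Icc 1 N.sqrt, ∑ n ∈ Finset.Icc 1 N.sqrt, f m n := by
  set s := N.sqrt
  have hs : s * s ≤ N := Nat.sqrt_le N
  have hlt : ∀ {m n : ℕ}, m * n ≤ N → m ≤ s ∨ n ≤ s := by
    intro m n h
    by_contra! h'
    exact absurd (Nat.mul_le_mul h'.1 h'.2) (not_le.2 (h.trans_lt (Nat.lt_succ_sqrt N)))
  set T := (Finset.Icc 1 N ×ˢ Finset.Icc 1 N).filter fun x => x.1 * x.2 ≤ N with hT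
  have hmemT : ∀ x : ℕ × ℕ, x ∈ T ↔ 1 ≤ x.1 ∧ 1 ≤ x.2 ∧ x.1 * x.2 ≤ N := by
    intro x
    simp only [hT, Finset.mem_filter, Finset.mem_product, Finset.mem_Icc]
    constructor
    · tauto
    · rintro ⟨h1, h2, h3⟩
      exact ⟨⟨⟨h1, (Nat.le_mul_of_pos_right _ h2).trans h3⟩,
        ⟨h2, (Nat.le_mul_of_pos_left _ h1).trans h3⟩⟩, h3⟩
  have h0 : ∑ n ∈ Finset.Icc 1 N, ∑ x ∈ n.divisorsAntidiagonal, f x.1 x.2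
      = ∑ x ∈ T, f x.1 x.2 := by
    rw [← Finset.sum_fiberwise_of_maps_to (s := T) (t := Finset.Icc 1 N) (g := fun x => x.1 * x.2)]
    · refine Finset.sum_congr rfl fun n hn => Finset.sum_congr ?_ fun _ _ => rfl
      rw [Finset.mem_Icc] at hn
      ext x
      simp only [Nat.mem_divisorsAntidiagonal, Finset.mem_filter, hmemT]
      constructor
      · rintro ⟨h1, h2⟩
        have : x.1 * x.2 ≠ 0 := by omega
        rw [mul_ne_zero_iff] at this
        omega
      · omega
    · intro x hx
      rw [hmemT] at hx
      exact Finset.mem_Icc.2 ⟨Nat.mul_pos hx.1 hx.2.1, hx.2.2⟩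
  have h1 : ∑ m ∈ Finset.Icc 1 s, ∑ n ∈ Finset.Icc 1 (N / m), f m n
      = ∑ x ∈ T with x.1 ≤ s, f x.1 x.2 := by
    refine (Finset.sum_finset_product (f := fun x => f x.1 x.2) _ _ _ fun x => ?_).symm
    simp only [Finset.mem_filter, hmemT, Finset.mem_Icc]
    constructor
    · rintro ⟨⟨h1, h2, h3⟩, h4⟩
      exact ⟨⟨h1, h4⟩, h2, (Nat.le_div_iff_mul_le h1).2 (by rwa [mul_comm])⟩
    · rintro ⟨⟨h1, h4⟩, h2, h3⟩
      rw [Nat.le_div_iff_mul_le h1, mul_comm] at h3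
      exact ⟨⟨h1, h2, h3⟩, h4⟩
  have h2 : ∑ x ∈ T with x.2 ≤ s, f x.1 x.2 = ∑ x ∈ T with x.1 ≤ s, f x.1 x.2 := by
    refine Finset.sum_bij' (fun x _ => x.swap) (fun x _ => x.swap) ?_ ?_ (by simp) (by simp)
      fun x _ => hf _ _ <;>
    · intro x hx
      simp only [Finset.mem_filter, hmemT, Prod.fst_swap, Prod.snd_swap] at hx ⊢
      rw [mul_comm]
      tauto
  have h3 : ∑ m ∈ Finset.Icc 1 s, ∑ n ∈ Finset.Icc 1 s, f m n
      = ∑ x ∈ (T.filter fun x => x.1 ≤ s) ∩ (T.filter fun x => x.2 ≤ s), f x.1 x.2 := by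
    refine (Finset.sum_finset_product (f := fun x => f x.1 x.2) _ _ _ fun x => ?_).symm
    simp only [Finset.mem_inter, Finset.mem_filter, hmemT, Finset.mem_Icc]
    constructor
    · tauto
    · rintro ⟨⟨h1, h4⟩, h2, h3⟩
      have := (Nat.mul_le_mul h4 h3).trans hs
      tauto
  have h4 : (T.filter fun x => x.1 ≤ s) ∪ (T.filter fun x => x.2 ≤ s) = T := by
    rw [← Finset.filter_or, Finset.filter_true_of_mem]
    intro x hx
    exact hlt ((hmemT x).1 hx).2.2
  have h5 := Finset.sum_union_inter (s₁ := T.filter fun x => x.1 ≤ s)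
    (s₂ := T.filter fun x => x.2 ≤ s) (f := fun x => f x.1 x.2)
  rw [h4, h2] at h5
  rw [h0, h1, h3]
  linarith

variable {f : ℕ → ℕ → ℝ} {B η : ℝ}

theorem abs_sum_Icc_le (hB : ∀ u v u' v', |∑ m ∈ Finset.Ico u v, ∑ n ∈ Finset.Ico u' v', f m n| ≤ B)
    (hη : ∀ m n, |f m n| ≤ f m n + η) (hη0 : 0 ≤ η) (N : ℕ) {u v : ℕ} (hu : 1 ≤ u) (huv : u ≤ v)
    {K : ℝ} (hK : 0 < K) (hvu : (v : ℝ) ≤ u * (1 + 2 / K)) :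
    |∑ m ∈ Finset.Icc u v, ∑ n ∈ Finset.Icc 1 (N / m), f m n|
      ≤ 2 * B + ∑ m ∈ Finset.Icc u v, η * (2 * N / K * (1 / m) + 1) := by
  have hIcc : ∀ a b : ℕ, Finset.Icc a b = Finset.Ico a (b + 1) := fun _ _ => rfl
  have hsplit : ∑ m ∈ Finset.Icc u v, ∑ n ∈ Finset.Icc 1 (N / m), f m n
      = ∑ m ∈ Finset.Icc u v, ∑ n ∈ Finset.Ico 1 (N / v + 1), f m n +
        ∑ m ∈ Finset.Icc u v, ∑ n ∈ Finset.Ico (N / v + 1) (N / m + 1), f m n := by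
    rw [← Finset.sum_add_distrib]
    refine Finset.sum_congr rfl fun m hm => ?_
    rw [Finset.mem_Icc] at hm
    have := Nat.div_le_div_left (a := N) hm.2 (by omega)
    exact (Finset.sum_Ico_consecutive _ (Nat.le_add_left 1 _) (by omega)).symm
  have h1 : |∑ m ∈ Finset.Icc u v, ∑ n ∈ Finset.Ico 1 (N / v + 1), f m n| ≤ B := hB u (v + 1) _ _
  have hu0 : 0 < (u : ℝ) := by exact_mod_cast hu
  have hv0 : 0 < (v : ℝ) := by exact_mod_cast hu.trans huv
  have hcard : ((N / u + 1 - (N / v + 1) : ℕ) : ℝ) ≤ 2 * N / K * (1 / v) + 1 := by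
    rw [Nat.cast_sub (by have := Nat.div_le_div_left (a := N) huv hu; omega)]
    push_cast
    have e1 : ((N / u : ℕ) : ℝ) ≤ N / u := Nat.cast_div_le
    have e2 : (N : ℝ) / v < (N / v : ℕ) + 1 := by
      rw [div_lt_iff₀ hv0]
      exact_mod_cast Nat.lt_mul_of_div_lt (Nat.lt_succ_self _) (hu.trans huv)
    have e3 : (N : ℝ) / u ≤ N / v + 2 * N / K * (1 / v) := by
      have : (N : ℝ) / v + 2 * N / K * (1 / v) = N * (1 + 2 / K) / v := by
        field_simp
      rw [this, div_le_div_iff₀ hu0 hv0]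
      have : (0 : ℝ) ≤ N := by positivity
      nlinarith
    linarith
  have h2 : |∑ m ∈ Finset.Icc u v, ∑ n ∈ Finset.Ico (N / v + 1) (N / m + 1), f m n|
      ≤ B + ∑ m ∈ Finset.Icc u v, η * (2 * N / K * (1 / m) + 1) := by
    calc _ ≤ ∑ m ∈ Finset.Icc u v, ∑ n ∈ Finset.Ico (N / v + 1) (N / m + 1), (f m n + η) := by
          refine (Finset.abs_sum_le_sum_abs _ _).trans (Finset.sum_le_sum fun m _ => ?_)
          exact (Finset.abs_sum_le_sum_abs _ _).trans (Finset.sum_le_sum fun n _ => hη m n)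
      _ ≤ ∑ m ∈ Finset.Icc u v, ∑ n ∈ Finset.Ico (N / v + 1) (N / u + 1), (f m n + η) := by
          refine Finset.sum_le_sum fun m hm => ?_
          rw [Finset.mem_Icc] at hm
          refine Finset.sum_le_sum_of_subset_of_nonneg ?_ fun n _ _ => (abs_nonneg _).trans (hη m n)
          exact Finset.Ico_subset_Ico le_rfl (Nat.succ_le_succ (Nat.div_le_div_left hm.1 hu))
      _ = ∑ m ∈ Finset.Icc u v, ∑ n ∈ Finset.Ico (N / v + 1) (N / u + 1), f m n +
          ∑ m ∈ Finset.Icc u v, η * ((N / u + 1 - (N / v + 1) : ℕ) : ℝ) := by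
          rw [← Finset.sum_add_distrib]
          refine Finset.sum_congr rfl fun m _ => ?_
          rw [Finset.sum_add_distrib, Finset.sum_const, Nat.card_Ico, nsmul_eq_mul, mul_comm η]
      _ ≤ _ := by
          refine add_le_add ((le_abs_self _).trans (hB u (v + 1) _ _)) ?_
          refine Finset.sum_le_sum fun m hm => mul_le_mul_of_nonneg_left (hcard.trans ?_) hη0
          rw [Finset.mem_Icc] at hm
          have : 0 < (m : ℝ) := by exact_mod_cast hu.trans hm.1
          have : (m : ℝ) ≤ v := by exact_mod_cast hm.2
          gcongr
  rw [hsplit]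
  exact (abs_add_le _ _).trans (by linarith)

theorem abs_sum_Icc_one_le
    (hB : ∀ u v u' v', |∑ m ∈ Finset.Ico u v, ∑ n ∈ Finset.Ico u' v', f m n| ≤ B)
    (hη : ∀ m n, |f m n| ≤ f m n + η) (hη0 : 0 ≤ η) (N s : ℕ) {K : ℝ} (hK : 1 ≤ K) :
    |∑ m ∈ Finset.Icc 1 s, ∑ n ∈ Finset.Icc 1 (N / m), f m n|
      ≤ (K * Real.log s + 1) * (2 * B) + η * (2 * N / K * (1 + Real.log s) + s) := by
  have hK0 : 0 < K := by linarith
  have hB0 : 0 ≤ B := (abs_nonneg _).trans (hB 0 0 0 0)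
  set g : ℕ → ℕ := fun m => ⌊K * Real.log m⌋₊ with hg
  have hlog : ∀ {m n : ℕ}, 1 ≤ m → m ≤ n → K * Real.log m ≤ K * Real.log n := by
    intro m n hm hmn
    have : 0 < (m : ℝ) := by exact_mod_cast hm
    gcongr
  have hlog0 : ∀ m : ℕ, 0 ≤ K * Real.log m := fun m =>
    mul_nonneg hK0.le (Real.log_natCast_nonneg m)
  have hmaps : ∀ m ∈ Finset.Icc 1 s, g m ∈ Finset.range (g s + 1) := by
    intro m hm
    rw [Finset.mem_Icc] at hm
    exact Finset.mem_range_succ_iff.2 (Nat.floor_le_floor (hlog hm.1 hm.2))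
  have hblock : ∀ i, |∑ m ∈ Finset.Icc 1 s with g m = i, ∑ n ∈ Finset.Icc 1 (N / m), f m n|
      ≤ 2 * B + ∑ m ∈ Finset.Icc 1 s with g m = i, η * (2 * N / K * (1 / m) + 1) := by
    intro i
    set F := (Finset.Icc 1 s).filter fun m => g m = i with hF
    rcases F.eq_empty_or_nonempty with h | h
    · simp [h, hB0]
    · have hu := F.min'_mem h
      have hv := F.max'_mem h
      set u := F.min' h
      set v := F.max' h
      have huv : u ≤ v := F.min'_le_max' h
      rw [hF, Finset.mem_filter, Finset.mem_Icc] at hu hv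
      have hFI : F = Finset.Icc u v := by
        ext m
        constructor
        · intro hm
          exact Finset.mem_Icc.2 ⟨F.min'_le m hm, F.le_max' m hm⟩
        · intro hm
          rw [Finset.mem_Icc] at hm
          rw [hF, Finset.mem_filter, Finset.mem_Icc]
          refine ⟨⟨by omega, by omega⟩, le_antisymm ?_ ?_⟩
          · rw [← hv.2]
            exact Nat.floor_le_floor (hlog (by omega) hm.2)
          · rw [← hu.2]
            exact Nat.floor_le_floor (hlog (by omega) hm.1)
      rw [hFI]
      refine abs_sum_Icc_le hB hη hη0 N hu.1.1 huv hK0 ?_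
      have hu0 : 0 < (u : ℝ) := by exact_mod_cast hu.1.1
      have hv0 : 0 < (v : ℝ) := by exact_mod_cast hv.1.1
      have e1 : (i : ℝ) ≤ K * Real.log u := by
        rw [← hu.2]
        exact Nat.floor_le (hlog0 u)
      have e2 : K * Real.log v < i + 1 := by
        rw [← hv.2]
        exact Nat.lt_floor_add_one _
      have e3 : Real.log (v / u) ≤ 1 / K := by
        rw [Real.log_div hv0.ne' hu0.ne', le_div_iff₀ hK0]
        linarith
      have e4 : Real.exp (1 / K) ≤ 1 + 2 / K := by
        have hK1 : 1 / K ≤ 1 := by rwa [div_le_one hK0]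
        have hK2 : 0 < 1 / K := by positivity
        have h1 := Real.abs_exp_sub_one_sub_id_le (x := 1 / K) (by rwa [abs_of_pos hK2])
        have h2 := (abs_le.1 h1).2
        have h3 : 2 / K = 2 * (1 / K) := by ring
        nlinarith
      have e5 := ((Real.log_le_iff_le_exp (div_pos hv0 hu0)).1 e3).trans e4
      rwa [div_le_iff₀' hu0] at e5
  have hH : ∑ m ∈ Finset.Icc 1 s, (1 / m : ℝ) ≤ 1 + Real.log s := by
    have h1 := harmonic_le_one_add_log s
    rw [harmonic_eq_sum_Icc] at h1
    push_cast at h1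
    simpa using h1
  rw [← Finset.sum_fiberwise_of_maps_to hmaps]
  calc _ ≤ ∑ i ∈ Finset.range (g s + 1), (2 * B +
        ∑ m ∈ Finset.Icc 1 s with g m = i, η * (2 * N / K * (1 / m) + 1)) :=
        (Finset.abs_sum_le_sum_abs _ _).trans (Finset.sum_le_sum fun i _ => hblock i)
    _ = (g s + 1) * (2 * B) + η * (2 * N / K * ∑ m ∈ Finset.Icc 1 s, (1 / m : ℝ) + s) := by
        rw [Finset.sum_add_distrib, Finset.sum_fiberwise_of_maps_to hmaps, Finset.sum_const,
          Finset.card_range, nsmul_eq_mul, ← Finset.mul_sum, Finset.sum_add_distrib,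
          ← Finset.mul_sum]
        simp
    _ ≤ _ := by
        have : (g s : ℝ) ≤ K * Real.log s := Nat.floor_le (hlog0 s)
        gcongr

theorem abs_sum_divisorsAntidiagonal_le
    (hB : ∀ u v u' v', |∑ m ∈ Finset.Ico u v, ∑ n ∈ Finset.Ico u' v', f m n| ≤ B)
    (hη : ∀ m n, |f m n| ≤ f m n + η) (hη0 : 0 ≤ η) (hf : ∀ m n, f m n = f n m) {X : ℝ}
    (hX : 1 ≤ X) {K : ℝ} (hK : 1 ≤ K) :
    |∑ n ∈ Finset.Icc 1 ⌊X⌋₊, ∑ x ∈ n.divisorsAntidiagonal, f x.1 x.2|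
      ≤ (4 * (K * Real.log X) + 5) * B + 2 * η * (2 * X / K * (1 + Real.log X) + √X) := by
  have hB0 : 0 ≤ B := (abs_nonneg _).trans (hB 0 0 0 0)
  set N := ⌊X⌋₊ with hN
  have hN1 : 1 ≤ N := (Nat.one_le_floor_iff X).2 hX
  have hNX : (N : ℝ) ≤ X := Nat.floor_le (by linarith)
  have hs : 1 ≤ N.sqrt := Nat.sqrt_pos.2 hN1
  have hsX : (N.sqrt : ℝ) ≤ √X := Real.nat_sqrt_le_real_sqrt.trans (Real.sqrt_le_sqrt hNX)
  have hsX' : (N.sqrt : ℝ) ≤ X := le_trans (by exact_mod_cast Nat.sqrt_le_self N) hNX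
  have hs0 : 0 < (N.sqrt : ℝ) := by exact_mod_cast hs
  have h1 := abs_sum_Icc_one_le hB hη hη0 N N.sqrt hK
  have h2 : |∑ m ∈ Finset.Icc 1 N.sqrt, ∑ n ∈ Finset.Icc 1 N.sqrt, f m n| ≤ B :=
    hB 1 (N.sqrt + 1) 1 (N.sqrt + 1)
  have h3 : (K * Real.log N.sqrt + 1) * (2 * B) + η * (2 * N / K * (1 + Real.log N.sqrt) + N.sqrt)
      ≤ (K * Real.log X + 1) * (2 * B) + η * (2 * X / K * (1 + Real.log X) + √X) := by
    have : 0 ≤ Real.log N.sqrt := Real.log_natCast_nonneg _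
    gcongr
  rw [sum_divisorsAntidiagonal_Icc_eq hf]
  refine (abs_sub _ _).trans ?_
  rw [abs_mul, abs_two]
  linarith

end Hyperbola

section DivisorFunction

theorem abs_hyperbolaDeviation_le {p : ℕ} [Fact p.Prime] (a x y : ZMod p) :
    |hyperbolaDeviation a x y| ≤ hyperbolaDeviation a x y + 2 / ((p : ℝ) - 1) := by
  have hp : 0 < (p : ℝ) - 1 := sub_pos.2 (by exact_mod_cast (Fact.out : p.Prime).one_lt)
  have h0 : 0 < 1 / ((p : ℝ) - 1) := by positivity
  have h2 : 2 / ((p : ℝ) - 1) = 2 * (1 / ((p : ℝ) - 1)) := by ring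
  rw [h2, abs_le, hyperbolaDeviation]
  constructor <;> split_ifs <;> linarith

theorem sum_hyperbolaDeviation_divisorsAntidiagonal {p : ℕ} [Fact p.Prime] (a : ZMod p) (n : ℕ) :
    ∑ x ∈ n.divisorsAntidiagonal, hyperbolaDeviation a (x.1 : ZMod p) (x.2 : ZMod p) =
      (if (n : ZMod p) = a then (n.divisors.card : ℝ) else 0) -
        (1 / ((p : ℝ) - 1)) * (if Nat.Coprime n p then (n.divisors.card : ℝ) else 0) := by
  have hp : p.Prime := Fact.out
  have h : ∀ x ∈ n.divisorsAntidiagonal, hyperbolaDeviation a (x.1 : ZMod p) (x.2 : ZMod p) =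
      (if (n : ZMod p) = a then 1 else 0) -
        (1 / ((p : ℝ) - 1)) * (if Nat.Coprime n p then 1 else 0) := by
    intro x hx
    have hxn : (x.1 : ZMod p) * (x.2 : ZMod p) = (n : ZMod p) := by
      rw [← Nat.cast_mul, (Nat.mem_divisorsAntidiagonal.1 hx).1]
    have hcop : Nat.Coprime n p ↔ (x.1 : ZMod p) ≠ 0 ∧ (x.2 : ZMod p) ≠ 0 := by
      rw [← mul_ne_zero_iff, hxn, Ne, ZMod.natCast_eq_zero_iff, Nat.coprime_comm,
        hp.coprime_iff_not_dvd]
    simp only [hyperbolaDeviation, hxn, hcop]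
  rw [Finset.sum_congr rfl h, Finset.sum_const, ← Nat.map_div_right_divisors, Finset.card_map,
    nsmul_eq_mul]
  split_ifs <;> ring

theorem abs_sum_divisors_card_sub_le {q : ℕ} (hq : q.Prime) {a : ℤ} (ha : Int.gcd a q = 1) {X : ℝ}
    (hX : 1 ≤ X) {K : ℝ} (hK : 1 ≤ K) :
    |(∑ n ∈ Finset.Icc 1 (Nat.floor X),
          if (n : ZMod q) = (a : ZMod q) then (n.divisors.card : ℝ) else 0)
        - (1 / (Nat.totient q : ℝ)) *
          ∑ n ∈ Finset.Icc 1 (Nat.floor X),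
            if Nat.Coprime n q then (n.divisors.card : ℝ) else 0|
      ≤ (4 * (K * Real.log X) + 5) * ((2 * √q + 1) * (1 + Real.log q) ^ 2) +
        2 * (2 / ((q : ℝ) - 1)) * (2 * X / K * (1 + Real.log X) + √X) := by
  have : Fact q.Prime := ⟨hq⟩
  have ha0 : (a : ZMod q) ≠ 0 := by
    rw [Ne, ZMod.intCast_zmod_eq_zero_iff_dvd]
    intro h
    have := Int.dvd_coe_gcd h (dvd_refl (q : ℤ))
    rw [ha] at this
    exact hq.one_lt.ne' (Nat.dvd_one.1 (by exact_mod_cast this))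
  have hη0 : 0 ≤ 2 / ((q : ℝ) - 1) :=
    div_nonneg zero_le_two (sub_nonneg.2 (by exact_mod_cast hq.one_lt.le))
  have h := abs_sum_divisorsAntidiagonal_le
    (f := fun m n => hyperbolaDeviation (a : ZMod q) (m : ZMod q) (n : ZMod q))
    (abs_sum_hyperbolaDeviation_le ha0) (fun m n => abs_hyperbolaDeviation_le _ _ _) hη0
    (fun m n => hyperbolaDeviation_comm _ _ _) hX hK
  simp only [sum_hyperbolaDeviation_divisorsAntidiagonal] at h
  rw [Finset.sum_sub_distrib, ← Finset.mul_sum] at h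
  rwa [Nat.totient_prime hq, Nat.cast_sub hq.one_lt.le, Nat.cast_one]

theorem log_pow_three_le {ε A X : ℝ} (hε : 0 < ε) (hA : 0 < A) (hX : 1 < X) :
    Real.log X ^ 3 ≤ (ε / (2 * (A + 3))) ^ (-(A + 3)) * X ^ (ε / 2) * Real.log X ^ (-A) := by
  set θ := ε / (2 * (A + 3)) with hθ
  have hθ0 : 0 < θ := by positivity
  have hL : 0 < Real.log X := Real.log_pos hX
  have hX0 : 0 < X := by linarith
  have h1 := Real.rpow_le_rpow hL.le (Real.log_le_rpow_div hX0.le hθ0) (by linarith : 0 ≤ A + 3)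
  rw [Real.div_rpow (by positivity) hθ0.le, ← Real.rpow_mul hX0.le,
    show θ * (A + 3) = ε / 2 by rw [hθ]; field_simp, div_eq_inv_mul, ← Real.rpow_neg hθ0.le] at h1
  calc Real.log X ^ 3 = Real.log X ^ (A + 3) * Real.log X ^ (-A) := by
        rw [← Real.rpow_add hL, ← Real.rpow_natCast]
        congr 1
        norm_num
    _ ≤ _ := by gcongr

theorem hyperbola_error_le {ε X q : ℝ} (hε0 : 0 < ε) (hε : ε < 2 / 3) (hX : 2 ≤ X) (hq : 2 ≤ q)
    (hqX : q ≤ X ^ (2 / 3 - ε)) :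
    (4 * (X ^ (ε / 2) * Real.log X) + 5) * ((2 * √q + 1) * (1 + Real.log q) ^ 2) +
        2 * (2 / (q - 1)) * (2 * X / X ^ (ε / 2) * (1 + Real.log X) + √X)
      ≤ 39 * (X / q) / X ^ (ε / 2) * (1 + Real.log X) ^ 3 := by
  have hX0 : 0 < X := by linarith
  have hX1 : 1 ≤ X := by linarith
  have hq0 : 0 < q := by linarith
  set L := Real.log X with hL
  set Y := X ^ (ε / 2) with hY
  have hL0 : 0 ≤ L := Real.log_nonneg hX1
  have hY1 : 1 ≤ Y := Real.one_le_rpow hX1 (by linarith)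
  have hY0 : 0 < Y := by linarith
  have hqX' : q ≤ X := hqX.trans ((Real.rpow_le_rpow_of_exponent_le hX1 (by linarith)).trans_eq
    (Real.rpow_one X))
  have hlq : Real.log q ≤ L := Real.log_le_log hq0 hqX'
  have hlq0 : 0 ≤ Real.log q := Real.log_nonneg (by linarith)
  have hsq : 1 ≤ √q := Real.one_le_sqrt.2 (by linarith)
  have hsX : √X ≤ X / Y := by
    rw [Real.sqrt_eq_rpow, hY, le_div_iff₀ hY0, ← Real.rpow_add hX0]
    exact (Real.rpow_le_rpow_of_exponent_le hX1 (by linarith)).trans_eq (Real.rpow_one X)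
  have hqs : q * √q ≤ X / Y ^ 3 := by
    have h1 : q * √q = q ^ (3 / 2 : ℝ) := by
      rw [Real.sqrt_eq_rpow, ← Real.rpow_one_add' hq0.le (by norm_num)]
      norm_num
    have h2 : X / Y ^ 3 = (X ^ (2 / 3 - ε)) ^ (3 / 2 : ℝ) := by
      rw [← Real.rpow_mul hX0.le, hY, ← Real.rpow_natCast, ← Real.rpow_mul hX0.le]
      nth_rewrite 1 [← Real.rpow_one X]
      rw [← Real.rpow_sub hX0]
      congr 1
      push_cast
      ring
    rw [h1, h2]
    exact Real.rpow_le_rpow hq0.le hqX (by norm_num)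
  have hmain : (4 * (Y * L) + 5) * ((2 * √q + 1) * (1 + Real.log q) ^ 2)
      ≤ 15 * (X / q) / Y * (1 + L) ^ 3 := by
    calc _ ≤ (5 * Y * (1 + L)) * ((3 * √q) * (1 + L) ^ 2) := by
          gcongr
          · nlinarith
          · linarith
      _ = 15 * (q * √q) / q * Y * (1 + L) ^ 3 := by
          field_simp
          ring
      _ ≤ 15 * (X / Y ^ 3) / q * Y * (1 + L) ^ 3 := by gcongr
      _ = 15 * (X / q) / Y * (1 + L) ^ 3 * (1 / Y) := by field_simp
      _ ≤ 15 * (X / q) / Y * (1 + L) ^ 3 * 1 := by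
          gcongr
          rwa [div_le_one hY0]
      _ = _ := mul_one _
  have hrest : 2 * (2 / (q - 1)) * (2 * X / Y * (1 + L) + √X)
      ≤ 24 * (X / q) / Y * (1 + L) ^ 3 := by
    have h1 : 2 / (q - 1) ≤ 4 / q := by
      rw [div_le_div_iff₀ (by linarith) hq0]
      linarith
    calc _ ≤ 2 * (4 / q) * (2 * X / Y * (1 + L) + X / Y * (1 + L)) := by
          have h2 : X / Y * 1 ≤ X / Y * (1 + L) := by gcongr; linarith
          have h3 : √X ≤ X / Y * (1 + L) := by linarith
          gcongr
      _ = 24 * (X / q) / Y * (1 + L) ^ 1 := by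
          field_simp
          ring
      _ ≤ 24 * (X / q) / Y * (1 + L) ^ 3 := by
          gcongr
          · linarith
          · norm_num
  calc _ ≤ 15 * (X / q) / Y * (1 + L) ^ 3 + 24 * (X / q) / Y * (1 + L) ^ 3 :=
        add_le_add hmain hrest
    _ = _ := by ring

end DivisorFunction

/-- Selberg's theorem on the divisor function in arithmetic progressions to large
moduli: for `0 < ε < 2/3` and `A > 0` there is `C = C(ε, A)` such that for every
`X ≥ 2`, every prime `q ≤ X^{2/3-ε}` and every integer `a` coprime to `q`,
`|E_X(d; q, a)| ≤ C (X/q) (log X)^{-A}`, where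
`E_X(d; q, a) = ∑_{n ≤ X, n ≡ a (q)} d(n) − (1/φ(q)) ∑_{n ≤ X, (n,q)=1} d(n)`. -/
theorem stmt_8 (ε A : ℝ) (hε0 : 0 < ε) (hε : ε < 2 / 3) (hA : 0 < A) :
    ∃ C : ℝ, ∀ X : ℝ, 2 ≤ X → ∀ q : ℕ, q.Prime → (q : ℝ) ≤ X ^ (2 / 3 - ε) →
      ∀ a : ℤ, Int.gcd a q = 1 →
        |(∑ n ∈ Finset.Icc 1 (Nat.floor X),
              if (n : ZMod q) = (a : ZMod q) then (n.divisors.card : ℝ) else 0)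
            - (1 / (Nat.totient q : ℝ)) *
              ∑ n ∈ Finset.Icc 1 (Nat.floor X),
                if Nat.Coprime n q then (n.divisors.card : ℝ) else 0|
          ≤ C * (X / q) * Real.log X ^ (-A) := by
  refine ⟨39 * 3 ^ 3 * (ε / (2 * (A + 3))) ^ (-(A + 3)), fun X hX q hq hqX a ha => ?_⟩
  have hX1 : 1 ≤ X := by linarith
  have hX0 : 0 < X := by linarith
  have hY0 : 0 < X ^ (ε / 2) := Real.rpow_pos_of_pos hX0 _
  have hq0 : 0 < (q : ℝ) := by exact_mod_cast hq.pos
  have hlog : 1 + Real.log X ≤ 3 * Real.log X := by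
    have := Real.log_le_log two_pos hX
    linarith [Real.log_two_gt_d9]
  refine (abs_sum_divisors_card_sub_le hq ha hX1
    (Real.one_le_rpow hX1 (by linarith : 0 ≤ ε / 2))).trans ?_
  refine (hyperbola_error_le hε0 hε hX (by exact_mod_cast hq.two_le) hqX).trans ?_
  calc 39 * (X / q) / X ^ (ε / 2) * (1 + Real.log X) ^ 3
      ≤ 39 * (X / q) / X ^ (ε / 2) * (3 * Real.log X) ^ 3 := by
        have := Real.log_nonneg hX1
        gcongr
    _ = 39 * 3 ^ 3 * (X / q) / X ^ (ε / 2) * Real.log X ^ 3 := by ring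
    _ ≤ 39 * 3 ^ 3 * (X / q) / X ^ (ε / 2) *
        ((ε / (2 * (A + 3))) ^ (-(A + 3)) * X ^ (ε / 2) * Real.log X ^ (-A)) := by
        gcongr
        exact log_pow_three_le hε0 hA (by linarith)
    _ = _ := by field_simp
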